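/- arXiv:2605.26780 — 2 statements merged into one kernel-verified Lean document; each statement's English description precedes it below -/
import Mathlib

section
/- Let real parameters (α, δ, μ, σ, η, λ, ξ, ζ) satisfy η ≥ 0, ξ ≥ 0, ζ ≥ 0, λ ≤ 0, 2α + 4πδ + μ − 4ζ ≥ 0, 2α + σ − 2η − 4ζ ≥ 0, and 6πα − πμ + 4πσ + 24πη + 4λ + 4ξ − 12πζ ≥ 0. Then W ≥ 0, where W = α∫₀^{2π}ρ(θ)²dθ + δL² + μA + σ|Ã| + η∫₀^{2π}ρ_β(θ)²dθ + λ(ρ_e − ρ_i)² + ξ(ρ_M − ρ_m)² + ζ∫₀^{2π}ρ(θ)⁻¹dθ. -/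
open MeasureTheory

noncomputable section

lemma aux_dir (f f1 : ℝ → ℝ) (hf : ∀ x, HasDerivAt f (f1 x) x) (hc : Continuous f1)
    (a b : ℝ) (hab : a ≤ b) (hπ : b - a ≤ Real.pi) (ha : f a = 0) (hb : f b = 0) :
    ∫ x in a..b, f x ^ 2 ≤ ∫ x in a..b, f1 x ^ 2 := by
  have hfc : Continuous f := continuous_iff_continuousAt.2 fun x => (hf x).continuousAt
  have key : ∀ k : ℝ, 0 < k → k < 1 → k ^ 2 * ∫ x in a..b, f x ^ 2 ≤ ∫ x in a..b, f1 x ^ 2 := by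
    intro k hk hk1
    set m := (a + b) / 2 with hm
    have hcos : ∀ x ∈ Set.uIcc a b, Real.cos (k * (x - m)) ≠ 0 := by
      intro x hx
      rw [Set.uIcc_of_le hab] at hx
      have hpi := Real.pi_pos
      apply ne_of_gt
      have habs : |x - m| ≤ Real.pi / 2 := by
        rw [abs_le]; constructor <;> linarith [hx.1, hx.2]
      have h2 : |k * (x - m)| < Real.pi / 2 := by
        rw [abs_mul, abs_of_pos hk]
        nlinarith [abs_nonneg (x - m)]
      rw [abs_lt] at h2
      exact Real.cos_pos_of_mem_Ioo ⟨by linarith [h2.1], h2.2⟩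
    set w : ℝ → ℝ := fun x => k * Real.tan (k * (x - m)) with hw
    have hwd : ∀ x ∈ Set.uIcc a b, HasDerivAt w (k ^ 2 + w x ^ 2) x := by
      intro x hx
      have h1 : HasDerivAt (fun x => k * (x - m)) k x := by
        simpa using ((hasDerivAt_id x).sub_const m).const_mul k
      have h2 := ((Real.hasDerivAt_tan (hcos x hx)).comp x h1).const_mul k
      refine HasDerivAt.congr_deriv h2 ?_
      simp only [hw, Real.tan_eq_sin_div_cos]
      have := hcos x hx
      field_simp
      linarith [Real.sin_sq_add_cos_sq (k * (x - m))]
    have hwc : ContinuousOn w (Set.uIcc a b) := fun x hx => (hwd x hx).continuousAt.continuousWithinAt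
    have hd : ∀ x ∈ Set.uIcc a b, HasDerivAt (fun x => f x ^ 2 * w x)
        (2 * f x * f1 x * w x + f x ^ 2 * (k ^ 2 + w x ^ 2)) x := by
      intro x hx
      have := ((hf x).pow 2).mul (hwd x hx)
      refine HasDerivAt.congr_deriv this ?_
      simp
    have hdc : ContinuousOn (fun x => 2 * f x * f1 x * w x + f x ^ 2 * (k ^ 2 + w x ^ 2)) (Set.uIcc a b) := by
      fun_prop
    have h0 := intervalIntegral.integral_eq_sub_of_hasDerivAt hd hdc.intervalIntegrable
    simp only [ha, hb] at h0
    have hsq : 0 ≤ ∫ x in a..b, (f1 x + f x * w x) ^ 2 :=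
      intervalIntegral.integral_nonneg hab fun x _ => sq_nonneg _
    have e : ∫ x in a..b, (f1 x + f x * w x) ^ 2 =
        ∫ x in a..b, ((f1 x ^ 2 - k ^ 2 * f x ^ 2) + (2 * f x * f1 x * w x + f x ^ 2 * (k ^ 2 + w x ^ 2))) := by
      congr 1; ext x; ring
    rw [e, intervalIntegral.integral_add (Continuous.intervalIntegrable (by fun_prop) _ _) hdc.intervalIntegrable, h0,
      intervalIntegral.integral_sub (Continuous.intervalIntegrable (by fun_prop) _ _) (Continuous.intervalIntegrable (by fun_prop) _ _),
      intervalIntegral.integral_const_mul] at hsq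
    linarith
  have ht : Filter.Tendsto (fun k : ℝ => k ^ 2 * ∫ x in a..b, f x ^ 2) (nhdsWithin 1 (Set.Iio 1))
      (nhds (1 ^ 2 * ∫ x in a..b, f x ^ 2)) := by
    apply Filter.Tendsto.mono_left _ nhdsWithin_le_nhds
    apply Continuous.tendsto
    fun_prop
  rw [one_pow, one_mul] at ht
  refine le_of_tendsto ht ?_
  filter_upwards [Ioo_mem_nhdsLT (show (0:ℝ) < 1 by norm_num)] with k hk
  exact key k hk.1 hk.2

lemma aux_opt (p : ℝ → ℝ) (hc : Continuous p) (hper : ∀ θ, p (θ + 2 * Real.pi) = p θ) :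
    ∃ c1 c2 m : ℝ, (∀ θ, p θ - c1 * Real.cos θ - c2 * Real.sin θ ≤ m) ∧
      ∀ a, ∃ θ ∈ Set.Icc a (a + Real.pi), p θ - c1 * Real.cos θ - c2 * Real.sin θ = m := by
  have hpi := Real.pi_pos
  have hP : Function.Periodic p (2 * Real.pi) := hper
  obtain ⟨x0, hx0, hmax⟩ := (isCompact_Icc (a := (0:ℝ)) (b := 2 * Real.pi)).exists_isMaxOn
    ⟨0, by constructor <;> linarith⟩ hc.continuousOn
  have hM : ∀ θ, p θ ≤ p x0 := by
    intro θ
    obtain ⟨y, hy, hyy⟩ := hP.exists_mem_Ico₀ (by linarith) θ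
    rw [hyy]; exact hmax ⟨hy.1, hy.2.le⟩
  set M0 := p x0
  let T : Set (ℝ × ℝ × ℝ) := {z | (∀ θ, p θ - z.1 * Real.cos θ - z.2.1 * Real.sin θ ≤ z.2.2) ∧ z.2.2 ≤ M0}
  have hTc : IsClosed T := by
    apply IsClosed.inter
    · show IsClosed {z : ℝ × ℝ × ℝ | ∀ θ, p θ - z.1 * Real.cos θ - z.2.1 * Real.sin θ ≤ z.2.2}
      rw [Set.ofPred_forall]
      exact isClosed_iInter fun θ => isClosed_le (by fun_prop) (by fun_prop)
    · exact isClosed_le (f := fun z : ℝ × ℝ × ℝ => z.2.2) (g := fun _ => M0) (by fun_prop) (by fun_prop)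
  have hTK : IsCompact T := by
    refine IsCompact.of_isClosed_subset (isCompact_Icc (a := ((p 0 - M0, p (Real.pi/2) - M0, (p 0 + p Real.pi)/2) : ℝ × ℝ × ℝ))
      (b := (M0 - p Real.pi, M0 - p (Real.pi / 2 + Real.pi), M0))) hTc ?_
    rintro ⟨c1, c2, m⟩ ⟨h1, h2⟩
    have e1 := h1 0
    have e2 := h1 Real.pi
    have e3 := h1 (Real.pi / 2)
    have e4 := h1 (Real.pi / 2 + Real.pi)
    simp at e1 e2 e3 e4 h2
    simp only [Set.mem_Icc, Prod.mk_le_mk]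
    refine ⟨⟨?_, ?_, ?_⟩, ?_, ?_, ?_⟩ <;> linarith
  have hne : T.Nonempty := ⟨(0, 0, M0), by intro θ; simpa using hM θ, le_refl _⟩
  obtain ⟨⟨c1, c2, m⟩, ⟨h1, h2⟩, hmin⟩ := hTK.exists_isMinOn hne (f := fun z => z.2.2) (by fun_prop)
  simp only at h1 h2
  refine ⟨c1, c2, m, h1, ?_⟩
  intro a
  by_contra hcon
  push Not at hcon
  have hlt : ∀ θ ∈ Set.Icc a (a + Real.pi), p θ - c1 * Real.cos θ - c2 * Real.sin θ < m :=
    fun θ hθ => lt_of_le_of_ne (h1 θ) (hcon θ hθ)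
  obtain ⟨x1, hx1, hmax1⟩ := (isCompact_Icc (a := a) (b := a + Real.pi)).exists_isMaxOn
    ⟨a, by constructor <;> linarith⟩
    (f := fun θ => p θ - c1 * Real.cos θ - c2 * Real.sin θ) (by fun_prop)
  set ε := m - (p x1 - c1 * Real.cos x1 - c2 * Real.sin x1) with hε
  have hεp : 0 < ε := by linarith [hlt x1 hx1]
  set t := ε / 2 with ht
  -- v = u(a + π/2) = (-sin a, cos a)
  set g : ℝ → ℝ := fun θ => p θ - (c1 + t * Real.sin a) * Real.cos θ - (c2 - t * Real.cos a) * Real.sin θ with hg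
  have hgc : Continuous g := by fun_prop
  have hge : ∀ θ, g θ = (p θ - c1 * Real.cos θ - c2 * Real.sin θ) + t * Real.sin (θ - a) := by
    intro θ; simp only [hg, Real.sin_sub]; ring
  have hgP : Function.Periodic g (2 * Real.pi) := by
    intro θ; simp only [hg, hper, Real.cos_add_two_pi, Real.sin_add_two_pi]
  obtain ⟨x2, hx2, hmax2⟩ := (isCompact_Icc (a := a) (b := a + 2 * Real.pi)).exists_isMaxOn
    ⟨a, by constructor <;> linarith⟩ hgc.continuousOn
  have hgm : ∀ θ ∈ Set.Icc a (a + 2 * Real.pi), g θ < m := by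
    intro θ hθ
    rw [hge]
    rcases le_or_gt θ (a + Real.pi) with h | h
    · have := hmax1 ⟨hθ.1, h⟩
      simp only [Set.mem_ofPred_eq] at this
      nlinarith [Real.sin_le_one (θ - a)]
    · rcases hθ.2.lt_or_eq with h' | h'
      · have : Real.sin (θ - a) < 0 := by
          have := Real.sin_pos_of_pos_of_lt_pi (x := θ - a - Real.pi) (by linarith) (by linarith)
          rw [Real.sin_sub_pi] at this; linarith
        have := h1 θ
        nlinarith
      · have e : p θ - c1 * Real.cos θ - c2 * Real.sin θ = p a - c1 * Real.cos a - c2 * Real.sin a := by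
          rw [h', hper, Real.cos_add_two_pi, Real.sin_add_two_pi]
        have e2 : θ - a = 2 * Real.pi := by linarith
        rw [e, e2, Real.sin_two_pi, mul_zero, add_zero]
        exact hlt a ⟨le_refl _, by linarith⟩
  have hgall : ∀ θ, g θ ≤ g x2 := by
    intro θ
    obtain ⟨y, hy, hyy⟩ := hgP.exists_mem_Ico (by linarith) θ a
    rw [hyy]; exact hmax2 ⟨hy.1, hy.2.le⟩
  have hx2m := hgm x2 hx2
  have : (c1 + t * Real.sin a, c2 - t * Real.cos a, g x2) ∈ T := ⟨hgall, by simp only; linarith⟩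
  have := hmin this
  simp only [Set.mem_ofPred_eq] at this
  linarith

lemma aux_zero (f f1 : ℝ → ℝ) (hf : ∀ x, HasDerivAt f (f1 x) x) (hc : Continuous f1)
    (hper : ∀ θ, f (θ + 2 * Real.pi) = f θ) (hz : ∀ a, ∃ θ ∈ Set.Icc a (a + Real.pi), f θ = 0) :
    ∫ x in (0:ℝ)..(2 * Real.pi), f x ^ 2 ≤ ∫ x in (0:ℝ)..(2 * Real.pi), f1 x ^ 2 := by
  have hpi := Real.pi_pos
  have hfc : Continuous f := continuous_iff_continuousAt.2 fun x => (hf x).continuousAt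
  have hf1per : ∀ θ, f1 (θ + 2 * Real.pi) = f1 θ := by
    intro θ
    have h1 := (hf (θ + 2 * Real.pi)).comp_add_const θ (2 * Real.pi)
    simp only [hper] at h1
    exact h1.unique (hf θ)
  obtain ⟨z0, -, hz0⟩ := hz 0
  have hcl : ∀ a b, IsCompact (Set.Icc a b ∩ f ⁻¹' {0}) := fun a b =>
    isCompact_Icc.inter_right (isClosed_singleton.preimage hfc)
  obtain ⟨y1, hy1, hy1'⟩ := hz z0
  obtain ⟨y2, hy2, hy2'⟩ := hz (z0 + Real.pi)
  obtain ⟨z1, ⟨hz1, hz1'⟩, hmax⟩ := (hcl z0 (z0 + Real.pi)).exists_isMaxOn ⟨y1, hy1, hy1'⟩ (f := fun x : ℝ => x) (by fun_prop)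
  obtain ⟨z2, ⟨hz2, hz2'⟩, hmin⟩ := (hcl (z0 + Real.pi) (z0 + Real.pi + Real.pi)).exists_isMinOn ⟨y2, hy2, hy2'⟩ (f := fun x : ℝ => x) (by fun_prop)
  have hgap : z2 - z1 ≤ Real.pi := by
    by_contra hcon
    push Not at hcon
    obtain ⟨y, hy, hy'⟩ := hz ((z1 + (z2 - Real.pi)) / 2)
    rcases le_or_gt y (z0 + Real.pi) with h | h
    · have : y ≤ z1 := hmax ⟨⟨by linarith [hy.1, hz1.1], h⟩, hy'⟩
      linarith [hy.1]
    · have : z2 ≤ y := hmin ⟨⟨h.le, by linarith [hy.2, hz2.2]⟩, hy'⟩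
      linarith [hy.2]
  have P0 : Function.Periodic (fun x => f x ^ 2) (2 * Real.pi) := by intro x; simp only [hper]
  have P1 : Function.Periodic (fun x => f1 x ^ 2) (2 * Real.pi) := by intro x; simp only [hf1per]
  have E0 := P0.intervalIntegral_add_eq 0 z0
  have E1 := P1.intervalIntegral_add_eq 0 z0
  rw [zero_add] at E0 E1
  rw [E0, E1]
  have hz3 : f (z0 + 2 * Real.pi) = 0 := by rw [hper, hz0]
  have i0 : ∀ a b, IntervalIntegrable (fun x => f x ^ 2) volume a b := fun a b => Continuous.intervalIntegrable (by fun_prop) _ _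
  have i1 : ∀ a b, IntervalIntegrable (fun x => f1 x ^ 2) volume a b := fun a b => Continuous.intervalIntegrable (by fun_prop) _ _
  rw [← intervalIntegral.integral_add_adjacent_intervals (i0 z0 z2) (i0 z2 _),
    ← intervalIntegral.integral_add_adjacent_intervals (i0 z0 z1) (i0 z1 _),
    ← intervalIntegral.integral_add_adjacent_intervals (i1 z0 z2) (i1 z2 _),
    ← intervalIntegral.integral_add_adjacent_intervals (i1 z0 z1) (i1 z1 _)]
  have d1 := aux_dir f f1 hf hc z0 z1 hz1.1 (by linarith [hz1.2]) hz0 hz1'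
  have d2 := aux_dir f f1 hf hc z1 z2 (by linarith [hz1.2, hz2.1]) hgap hz1' hz2'
  have d3 := aux_dir f f1 hf hc z2 (z0 + 2 * Real.pi) (by linarith [hz2.2]) (by linarith [hz2.1]) hz2' hz3
  linarith

lemma aux_bonn (p p1 : ℝ → ℝ) (hf : ∀ x, HasDerivAt p (p1 x) x) (hc : Continuous p1)
    (hper : ∀ θ, p (θ + 2 * Real.pi) = p θ) :
    ∃ c1 c2 m : ℝ, (∀ θ, p θ - c1 * Real.cos θ - c2 * Real.sin θ ≤ m) ∧
      ∫ x in (0:ℝ)..(2 * Real.pi), (p x - m) ^ 2 ≤ ∫ x in (0:ℝ)..(2 * Real.pi), p1 x ^ 2 := by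
  have hfc : Continuous p := continuous_iff_continuousAt.2 fun x => (hf x).continuousAt
  obtain ⟨c1, c2, m, h1, h2⟩ := aux_opt p hfc hper
  refine ⟨c1, c2, m, h1, ?_⟩
  have hd : ∀ x, HasDerivAt (fun θ => p θ - c1 * Real.cos θ - c2 * Real.sin θ - m)
      (p1 x + c1 * Real.sin x - c2 * Real.cos x) x := by
    intro x
    have := ((((hf x).sub ((Real.hasDerivAt_cos x).const_mul c1)).sub ((Real.hasDerivAt_sin x).const_mul c2))).sub_const m
    refine HasDerivAt.congr_deriv this ?_
    ring
  have h := aux_zero _ _ hd (by fun_prop) (by intro θ; simp only [hper, Real.cos_add_two_pi, Real.sin_add_two_pi])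
    (fun a => by
      obtain ⟨θ, hθ, e⟩ := h2 a
      exact ⟨θ, hθ, by simp only [e, sub_self]⟩)
  -- exact derivative
  have hG : ∀ x, HasDerivAt (fun x => (p x - m) * (2 * (c1 * Real.sin x - c2 * Real.cos x)) 
      - (c1 * Real.cos x + c2 * Real.sin x) * (c1 * Real.sin x - c2 * Real.cos x))
      (((p1 x + c1 * Real.sin x - c2 * Real.cos x) ^ 2 - (p x - c1 * Real.cos x - c2 * Real.sin x - m) ^ 2)
        - (p1 x ^ 2 - (p x - m) ^ 2)) x := by
    intro x
    have s := ((Real.hasDerivAt_sin x).const_mul c1).sub ((Real.hasDerivAt_cos x).const_mul c2)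
    have c := ((Real.hasDerivAt_cos x).const_mul c1).add ((Real.hasDerivAt_sin x).const_mul c2)
    have := (((hf x).sub_const m).mul (s.const_mul 2)).sub (c.mul s)
    refine HasDerivAt.congr_deriv this ?_
    simp
    ring
  have h0 := intervalIntegral.integral_eq_sub_of_hasDerivAt (fun x _ => hG x)
    (Continuous.intervalIntegrable (by fun_prop) 0 (2 * Real.pi))
  have hp2 : p (2 * Real.pi) = p 0 := by simpa using hper 0
  simp only [hp2, Real.cos_two_pi, Real.sin_two_pi, Real.cos_zero, Real.sin_zero, sub_self] at h0
  have ii : ∀ g : ℝ → ℝ, Continuous g → IntervalIntegrable g volume 0 (2 * Real.pi) := fun g hg => hg.intervalIntegrable _ _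
  rw [intervalIntegral.integral_sub (ii _ (by fun_prop)) (ii _ (by fun_prop)),
    intervalIntegral.integral_sub (ii _ (by fun_prop)) (ii _ (by fun_prop)),
    intervalIntegral.integral_sub (ii _ (by fun_prop)) (ii _ (by fun_prop))] at h0
  linarith

lemma aux_coeff (f f1 : ℝ → ℝ) (hf : ∀ x, HasDerivAt f (f1 x) x) (hc : Continuous f1)
    (hper : f (2 * Real.pi) = f 0) (n : ℤ) :
    ‖fourierCoeffOn Real.two_pi_pos (fun x => (f1 x : ℂ)) n‖ ^ 2 =
      (n : ℝ) ^ 2 * ‖fourierCoeffOn Real.two_pi_pos (fun x => (f x : ℂ)) n‖ ^ 2 := by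
  have hpi := Real.pi_pos
  by_cases hn : n = 0
  · subst hn
    have : ∫ x in (0:ℝ)..(2 * Real.pi), (f1 x : ℂ) = 0 := by
      rw [intervalIntegral.integral_ofReal, intervalIntegral.integral_eq_sub_of_hasDerivAt (fun x _ => hf x)
        (hc.intervalIntegrable _ _), hper]
      simp
    rw [fourierCoeffOn_eq_integral]
    simp [this]
  · have h := fourierCoeffOn_of_hasDerivAt Real.two_pi_pos (f := fun x => (f x : ℂ)) (f' := fun x => (f1 x : ℂ)) hn
      (fun x _ => (hf x).ofReal_comp) (Continuous.intervalIntegrable (by fun_prop) _ _)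
    have hnn : (n : ℂ) ≠ 0 := by exact_mod_cast hn
    have hpp : (Real.pi : ℂ) ≠ 0 := by exact_mod_cast hpi.ne'
    have h2 : fourierCoeffOn Real.two_pi_pos (fun x => (f1 x : ℂ)) n =
        Complex.I * n * fourierCoeffOn Real.two_pi_pos (fun x => (f x : ℂ)) n := by
      rw [h, hper]
      push_cast
      have := Complex.I_ne_zero
      field_simp
      ring
    rw [h2]
    simp only [norm_mul, Complex.norm_I, one_mul, mul_pow]
    congr 1
    rw [Complex.norm_intCast, sq_abs]

lemma aux_pars (f : ℝ → ℝ) (hc : Continuous f) :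
    HasSum (fun n : ℤ => ‖fourierCoeffOn Real.two_pi_pos (fun x => (f x : ℂ)) n‖ ^ 2)
      ((2 * Real.pi)⁻¹ * ∫ x in (0:ℝ)..(2 * Real.pi), f x ^ 2) := by
  have h := hasSum_sq_fourierCoeffOn Real.two_pi_pos (f := fun x => (f x : ℂ)) (by
    have hcc : Continuous (fun x => (f x : ℂ)) := by fun_prop
    obtain ⟨C, hC⟩ := (isCompact_Icc (a := (0:ℝ)) (b := 2 * Real.pi)).exists_bound_of_continuousOn hcc.continuousOn
    refine MemLp.of_bound hcc.aestronglyMeasurable C ?_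
    refine (ae_restrict_iff' measurableSet_Ioc).2 (Filter.Eventually.of_forall fun x hx => ?_)
    exact hC x ⟨hx.1.le, hx.2⟩)
  simpa using h

lemma aux_w1 (f f1 : ℝ → ℝ) (hf : ∀ x, HasDerivAt f (f1 x) x) (hc : Continuous f1)
    (hper : f (2 * Real.pi) = f 0) (h0 : ∫ x in (0:ℝ)..(2 * Real.pi), f x = 0) :
    ∫ x in (0:ℝ)..(2 * Real.pi), f x ^ 2 ≤ ∫ x in (0:ℝ)..(2 * Real.pi), f1 x ^ 2 := by
  have hfc : Continuous f := continuous_iff_continuousAt.2 fun x => (hf x).continuousAt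
  have s0 := aux_pars f hfc
  have s1 := aux_pars f1 hc
  have hle := hasSum_le (fun n => ?_) s0 s1
  · have hpi := Real.two_pi_pos
    exact le_of_mul_le_mul_left hle (inv_pos.2 hpi)
  · rw [aux_coeff f f1 hf hc hper]
    by_cases hn : n = 0
    · subst hn
      have : fourierCoeffOn Real.two_pi_pos (fun x => (f x : ℂ)) 0 = 0 := by
        rw [fourierCoeffOn_eq_integral]
        simp [intervalIntegral.integral_ofReal, h0]
      simp [this]
    · have : (1:ℝ) ≤ (n:ℝ) ^ 2 := by
        have : (1:ℤ) ≤ n ^ 2 := by have := sq_nonneg n; have : n^2 ≠ 0 := pow_ne_zero 2 hn; omega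
        exact_mod_cast this
      nlinarith [sq_nonneg ‖fourierCoeffOn Real.two_pi_pos (fun x => (f x : ℂ)) n‖]

lemma aux_w2 (f f1 f2 : ℝ → ℝ) (hf : ∀ x, HasDerivAt f (f1 x) x) (hf1 : ∀ x, HasDerivAt f1 (f2 x) x) (hc : Continuous f2)
    (hper : f (2 * Real.pi) = f 0) (hper1 : f1 (2 * Real.pi) = f1 0) :
    0 ≤ (∫ x in (0:ℝ)..(2 * Real.pi), f2 x ^ 2) - 5 * (∫ x in (0:ℝ)..(2 * Real.pi), f1 x ^ 2)
      + 4 * ∫ x in (0:ℝ)..(2 * Real.pi), f x ^ 2 := by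
  have hfc : Continuous f := continuous_iff_continuousAt.2 fun x => (hf x).continuousAt
  have hfc1 : Continuous f1 := continuous_iff_continuousAt.2 fun x => (hf1 x).continuousAt
  have s0 := aux_pars f hfc
  have s1 := aux_pars f1 hfc1
  have s2 := aux_pars f2 hc
  have hs := (s2.sub (s1.mul_left 5)).add (s0.mul_left 4)
  have hle := hs.nonneg (fun n => ?_)
  · have hpi := inv_pos.2 Real.two_pi_pos
    refine nonneg_of_mul_nonneg_right (b := _) ?_ hpi
    refine hle.trans_eq ?_
    ring
  · rw [aux_coeff f1 f2 hf1 hc hper1, aux_coeff f f1 hf hfc1 hper]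
    by_cases hn : n = 0
    · subst hn
      simp
    · have : (0:ℝ) ≤ ((n:ℝ) ^ 2 - 1) * ((n:ℝ) ^ 2 - 4) := by
        have : (0:ℤ) ≤ (n ^ 2 - 1) * (n ^ 2 - 4) := by
          by_cases h1 : n = 1
          · subst h1; norm_num
          by_cases h2 : n = -1
          · subst h2; norm_num
          have h3 : 4 ≤ n ^ 2 := by
            rcases lt_or_gt_of_ne hn with h | h
            · have : n ≤ -2 := by omega
              nlinarith
            · have : 2 ≤ n := by omega
              nlinarith
          apply mul_nonneg <;> linarith
        exact_mod_cast this
      have := mul_nonneg this (sq_nonneg ‖fourierCoeffOn Real.two_pi_pos (fun x => (f x : ℂ)) n‖)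
      refine this.trans_eq ?_
      ring

lemma le_of_sq_le_sq0 {a b : ℝ} (h : a ^ 2 ≤ b ^ 2) (hb : 0 ≤ b) : a ≤ b := by
  by_contra hc
  push Not at hc
  nlinarith


lemma aux_ball (c1 c2 r x1 x2 : ℝ) (hr : 0 ≤ r) 
    (h : ∀ θ : ℝ, (x1 - c1) * Real.cos θ + (x2 - c2) * Real.sin θ ≤ r) :
    (x1 - c1) ^ 2 + (x2 - c2) ^ 2 ≤ r ^ 2 := by
  set z : ℂ := ⟨x1 - c1, x2 - c2⟩
  have h1 := h z.arg
  have e1 : x1 - c1 = ‖z‖ * Real.cos z.arg := (Complex.norm_mul_cos_arg z).symm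
  have e2 : x2 - c2 = ‖z‖ * Real.sin z.arg := (Complex.norm_mul_sin_arg z).symm
  rw [e1, e2] at h1 ⊢
  have e3 := Real.sin_sq_add_cos_sq z.arg
  have e4 : ‖z‖ ≤ r := by nlinarith
  have := norm_nonneg z
  calc _ = ‖z‖ ^ 2 * (Real.sin z.arg ^ 2 + Real.cos z.arg ^ 2) := by ring
    _ ≤ r ^ 2 := by rw [e3]; nlinarith

lemma aux_dist (x c : EuclideanSpace ℝ (Fin 2)) (r : ℝ) (hr : 0 ≤ r) :
    x ∈ Metric.closedBall c r ↔ (x 0 - c 0) ^ 2 + (x 1 - c 1) ^ 2 ≤ r ^ 2 := by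
  rw [Metric.mem_closedBall, EuclideanSpace.dist_eq, Real.sqrt_le_left hr, Fin.sum_univ_two]
  simp [Real.dist_eq, sq_abs]

lemma aux_geo (p : ℝ → ℝ) (K : Set (EuclideanSpace ℝ (Fin 2)))
    (hK : K = {x | ∀ θ : ℝ, x 0 * Real.cos θ + x 1 * Real.sin θ ≤ p θ})
    (ρe ρi : ℝ)
    (hρe : ρe = sInf {r : ℝ | 0 ≤ r ∧ ∃ c, K ⊆ Metric.closedBall c r})
    (hρi : ρi = sSup {r : ℝ | 0 ≤ r ∧ ∃ c, Metric.closedBall c r ⊆ K})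
    (c1 c2 m d1 d2 k : ℝ) (hm0 : 0 ≤ m)
    (hm : ∀ θ, p θ - c1 * Real.cos θ - c2 * Real.sin θ ≤ m)
    (hk : ∀ θ, - p θ - d1 * Real.cos θ - d2 * Real.sin θ ≤ - k) :
    0 ≤ ρe - ρi ∧ ρe - ρi ≤ m - k := by
  have hmem : m ∈ {r : ℝ | 0 ≤ r ∧ ∃ c, K ⊆ Metric.closedBall c r} := by
    refine ⟨hm0, !₂[c1, c2], ?_⟩
    intro x hx
    rw [hK] at hx
    rw [aux_dist _ _ _ hm0]
    simp only [PiLp.toLp_apply, Matrix.cons_val_zero, Matrix.cons_val_one]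
    apply aux_ball _ _ _ _ _ hm0
    intro θ
    have := hx θ
    have := hm θ
    linarith
  have hpt : ∀ (c : EuclideanSpace ℝ (Fin 2)) (r : ℝ), 0 ≤ r → ∀ s : ℝ, s ^ 2 = r ^ 2 →
      !₂[c 0 + s, c 1] ∈ Metric.closedBall c r := by
    intro c r hr s hs
    rw [aux_dist _ _ _ hr]
    simp [hs]
  have h1 : ρe ≤ m := by
    rw [hρe]; exact csInf_le ⟨0, fun r hr => hr.1⟩ hmem
  have h2 : k ≤ ρi := by
    rw [hρi]
    rcases le_or_gt 0 k with hk0 | hk0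
    · apply le_csSup
      · refine ⟨(p 0 + p Real.pi) / 2, ?_⟩
        rintro r ⟨hr, c, hc⟩
        have a1 := hc (hpt c r hr r rfl)
        have a2 := hc (hpt c r hr (-r) (by ring))
        rw [hK] at a1 a2
        have b1 := a1 0
        have b2 := a2 Real.pi
        simp at b1 b2
        linarith
      · refine ⟨hk0, !₂[-d1, -d2], ?_⟩
        intro x hx
        rw [aux_dist _ _ _ hk0] at hx
        simp only [PiLp.toLp_apply, Matrix.cons_val_zero, Matrix.cons_val_one] at hx
        rw [hK]
        intro θ
        have e := hk θ
        have e3 := Real.sin_sq_add_cos_sq θ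
        have : (x 0 - -d1) * Real.cos θ + (x 1 - -d2) * Real.sin θ ≤ k := by
          apply le_of_sq_le_sq0 _ hk0
          nlinarith [sq_nonneg ((x 0 - -d1) * Real.sin θ - (x 1 - -d2) * Real.cos θ)]
        linarith
    · exact hk0.le.trans (Real.sSup_nonneg fun r hr => hr.1)
  refine ⟨?_, by linarith⟩
  rw [sub_nonneg, hρi]
  apply Real.sSup_le
  · rintro r ⟨hr, c, hc⟩
    rw [hρe]
    apply le_csInf ⟨m, hmem⟩
    rintro R ⟨hR, C, hC⟩
    have a1 := hC (hc (hpt c r hr r rfl))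
    have a2 := hC (hc (hpt c r hr (-r) (by ring)))
    rw [aux_dist _ _ _ hR] at a1 a2
    simp at a1 a2
    apply le_of_sq_le_sq0 _ hR
    nlinarith [sq_nonneg (c 0 - C 0), sq_nonneg (c 1 - C 1)]
  · rw [hρe]; exact Real.sInf_nonneg fun r hr => hr.1


lemma aux_main (J I0 I1 I2 I3 R V D M α δ μ σ η lam ξ ζ : ℝ) (hπ : 0 < Real.pi) (hR : 0 ≤ R)
    (hη : 0 ≤ η) (hξ : 0 ≤ ξ) (hζ : 0 ≤ ζ) (hlam : lam ≤ 0)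
    (hc1 : 0 ≤ 2 * α + 4 * Real.pi * δ + μ - 4 * ζ)
    (hc2 : 0 ≤ 2 * α + σ - 2 * η - 4 * ζ)
    (hc3 : 0 ≤ (6 * Real.pi * α - Real.pi * μ + 4 * Real.pi * σ + 24 * Real.pi * η + 4 * lam + 4 * ξ - 12 * Real.pi * ζ))
    (hD : D = I1 - (I0 - J ^ 2 / (2 * Real.pi))) (hD0 : 0 ≤ D)
    (hb : 0 ≤ I2 - 5 * I1 + 4 * (I0 - J ^ 2 / (2 * Real.pi)))
    (hcc : 0 ≤ I3 - 5 * I2 + 4 * I1)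
    (hρ : 0 ≤ I0 - 2 * I1 + I2)
    (hV : V ≤ 2 * D / Real.pi) (hM : 2 * D / Real.pi ≤ M) :
    0 ≤ α * (I0 - 2 * I1 + I2) + δ * J ^ 2 + μ * ((1/2) * (I0 - I1)) + σ * ((1/2) * (I2 - I1))
      + η * (I1 - 2 * I2 + I3) + lam * V + ξ * M + ζ * R := by
  have e1 := mul_nonneg hζ hR
  have e2 := mul_nonneg hζ hρ
  have e3 := mul_le_mul_of_nonneg_left hM hξ
  have e4 := mul_le_mul_of_nonpos_left hV hlam
  have e5 : 0 ≤ (2 * α + 4 * Real.pi * δ + μ - 4 * ζ) * (J ^ 2 / (4 * Real.pi)) := by positivity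
  have e6 := mul_nonneg hc2 hb
  have e7 := mul_nonneg hη hcc
  have e8 := mul_nonneg hη hb
  have e9 : 0 ≤ (6 * Real.pi * α - Real.pi * μ + 4 * Real.pi * σ + 24 * Real.pi * η + 4 * lam + 4 * ξ - 12 * Real.pi * ζ) * (D / (2 * Real.pi)) := by positivity
  have key : α * (I0 - 2 * I1 + I2) + δ * J ^ 2 + μ * ((1/2) * (I0 - I1)) + σ * ((1/2) * (I2 - I1))
      + η * (I1 - 2 * I2 + I3) + lam * (2 * D / Real.pi) + ξ * (2 * D / Real.pi) = 
      2 * (ζ * (I0 - 2 * I1 + I2)) + (2 * α + 4 * Real.pi * δ + μ - 4 * ζ) * (J ^ 2 / (4 * Real.pi))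
      + (1/2) * ((2 * α + σ - 2 * η - 4 * ζ) * (I2 - 5 * I1 + 4 * (I0 - J ^ 2 / (2 * Real.pi))))
      + η * (I3 - 5 * I2 + 4 * I1) + 4 * (η * (I2 - 5 * I1 + 4 * (I0 - J ^ 2 / (2 * Real.pi))))
      + (6 * Real.pi * α - Real.pi * μ + 4 * Real.pi * σ + 24 * Real.pi * η + 4 * lam + 4 * ξ - 12 * Real.pi * ζ) * (D / (2 * Real.pi)) := by
    rw [hD]
    field_simp
    ring
  linarith

set_option maxHeartbeats 1000000 in
theorem stmt0
    (p : ℝ → ℝ)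
    (hp : ContDiff ℝ (⊤ : ℕ∞) p)
    (hper : ∀ θ : ℝ, p (θ + 2 * Real.pi) = p θ)
    (ρ : ℝ → ℝ)
    (hρdef : ρ = fun θ => p θ + iteratedDeriv 2 p θ)
    (hρpos : ∀ θ : ℝ, 0 < ρ θ)
    (L A : ℝ)
    (hL : L = ∫ θ in (0:ℝ)..(2 * Real.pi), ρ θ)
    (hA : A = (1 / 2) * ∫ θ in (0:ℝ)..(2 * Real.pi), (p θ ^ 2 - deriv p θ ^ 2))
    (Atilde : ℝ)
    (hAt : Atilde = (1 / 2) * ∫ θ in (0:ℝ)..(2 * Real.pi), (deriv p θ ^ 2 - iteratedDeriv 2 p θ ^ 2))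
    (ρβ : ℝ → ℝ)
    (hρβ : ρβ = fun θ => |deriv p θ + iteratedDeriv 3 p θ|)
    (ρM ρm : ℝ)
    (hρM : ρM = sSup (ρ '' Set.Icc (0:ℝ) (2 * Real.pi)))
    (hρm : ρm = sInf (ρ '' Set.Icc (0:ℝ) (2 * Real.pi)))
    (K : Set (EuclideanSpace ℝ (Fin 2)))
    (hK : K = {x | ∀ θ : ℝ, x 0 * Real.cos θ + x 1 * Real.sin θ ≤ p θ})
    (ρe ρi : ℝ)
    (hρe : ρe = sInf {r : ℝ | 0 ≤ r ∧ ∃ c, K ⊆ Metric.closedBall c r})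
    (hρi : ρi = sSup {r : ℝ | 0 ≤ r ∧ ∃ c, Metric.closedBall c r ⊆ K})
    (α δ μ σ η lam ξ ζ : ℝ)
    (W : ℝ)
    (hW : W = α * (∫ θ in (0:ℝ)..(2 * Real.pi), ρ θ ^ 2) + δ * L ^ 2 + μ * A + σ * |Atilde|
      + η * (∫ θ in (0:ℝ)..(2 * Real.pi), ρβ θ ^ 2) + lam * (ρe - ρi) ^ 2
      + ξ * (ρM - ρm) ^ 2 + ζ * (∫ θ in (0:ℝ)..(2 * Real.pi), (ρ θ)⁻¹))
    (hη : 0 ≤ η) (hξ : 0 ≤ ξ) (hζ : 0 ≤ ζ) (hlam : lam ≤ 0)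
    (hc1 : 0 ≤ 2 * α + 4 * Real.pi * δ + μ - 4 * ζ)
    (hc2 : 0 ≤ 2 * α + σ - 2 * η - 4 * ζ)
    (hc3 : 0 ≤ (6 * Real.pi * α - Real.pi * μ + 4 * Real.pi * σ + 24 * Real.pi * η + 4 * lam + 4 * ξ - 12 * Real.pi * ζ)) :
    0 ≤ W := by
  have hpi := Real.pi_pos
  have h2pi := Real.two_pi_pos
  set p1 := deriv p with hp1
  set p2 := iteratedDeriv 2 p with hp2
  set p3 := iteratedDeriv 3 p with hp3
  have hp2' : p2 = deriv p1 := by rw [hp2, iteratedDeriv_succ, iteratedDeriv_one]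
  have hp3' : p3 = deriv p2 := by rw [hp3, iteratedDeriv_succ]
  have cd1 : ContDiff ℝ (⊤ : ℕ∞) p1 := (contDiff_infty_iff_deriv.1 hp).2
  have cd2 : ContDiff ℝ (⊤ : ℕ∞) p2 := by rw [hp2']; exact (contDiff_infty_iff_deriv.1 cd1).2
  have cd3 : ContDiff ℝ (⊤ : ℕ∞) p3 := by rw [hp3']; exact (contDiff_infty_iff_deriv.1 cd2).2
  have d0 : ∀ x, HasDerivAt p (p1 x) x := fun x => ((contDiff_infty_iff_deriv.1 hp).1 x).hasDerivAt
  have d1 : ∀ x, HasDerivAt p1 (p2 x) x := fun x => by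
    rw [hp2']; exact ((contDiff_infty_iff_deriv.1 cd1).1 x).hasDerivAt
  have d2 : ∀ x, HasDerivAt p2 (p3 x) x := fun x => by
    rw [hp3']; exact ((contDiff_infty_iff_deriv.1 cd2).1 x).hasDerivAt
  have c0 : Continuous p := hp.continuous
  have c1 : Continuous p1 := cd1.continuous
  have c2 : Continuous p2 := cd2.continuous
  have c3 : Continuous p3 := cd3.continuous
  have perD : ∀ f f1 : ℝ → ℝ, (∀ x, HasDerivAt f (f1 x) x) → (∀ θ, f (θ + 2 * Real.pi) = f θ) →
      ∀ θ, f1 (θ + 2 * Real.pi) = f1 θ := by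
    intro f f1 hf hper θ
    have h1 := (hf (θ + 2 * Real.pi)).comp_add_const θ (2 * Real.pi)
    simp only [hper] at h1
    exact h1.unique (hf θ)
  have per1 := perD _ _ d0 hper
  have per2 := perD _ _ d1 per1
  have q0 : p (2 * Real.pi) = p 0 := by simpa using hper 0
  have q1 : p1 (2 * Real.pi) = p1 0 := by simpa using per1 0
  have q2 : p2 (2 * Real.pi) = p2 0 := by simpa using per2 0
  have ii : ∀ g : ℝ → ℝ, Continuous g → IntervalIntegrable g volume 0 (2 * Real.pi) :=
    fun g hg => hg.intervalIntegrable _ _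
  set J := ∫ x in (0:ℝ)..(2 * Real.pi), p x with hJ
  set I0 := ∫ x in (0:ℝ)..(2 * Real.pi), p x ^ 2 with hI0
  set I1 := ∫ x in (0:ℝ)..(2 * Real.pi), p1 x ^ 2 with hI1
  set I2 := ∫ x in (0:ℝ)..(2 * Real.pi), p2 x ^ 2 with hI2
  set I3 := ∫ x in (0:ℝ)..(2 * Real.pi), p3 x ^ 2 with hI3
  have z1 : ∫ x in (0:ℝ)..(2 * Real.pi), p1 x = 0 := by
    rw [intervalIntegral.integral_eq_sub_of_hasDerivAt (fun x _ => d0 x) (ii _ c1), q0, sub_self]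
  have z2 : ∫ x in (0:ℝ)..(2 * Real.pi), p2 x = 0 := by
    rw [intervalIntegral.integral_eq_sub_of_hasDerivAt (fun x _ => d1 x) (ii _ c2), q1, sub_self]
  have m02 : ∫ x in (0:ℝ)..(2 * Real.pi), p x * p2 x = - I1 := by
    rw [intervalIntegral.integral_mul_deriv_eq_deriv_mul (fun x _ => d0 x) (fun x _ => d1 x) (ii _ c1) (ii _ c2), q0, q1, hI1]
    simp only [sub_self, zero_sub, pow_two]
  have m13 : ∫ x in (0:ℝ)..(2 * Real.pi), p1 x * p3 x = - I2 := by
    rw [intervalIntegral.integral_mul_deriv_eq_deriv_mul (fun x _ => d1 x) (fun x _ => d2 x) (ii _ c2) (ii _ c3), q1, q2, hI2]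
    simp only [sub_self, zero_sub, pow_two]
  have cρ : Continuous ρ := by rw [hρdef]; fun_prop
  have hLJ : L = J := by
    rw [hL, hρdef, intervalIntegral.integral_add (ii _ c0) (ii _ c2), z2, add_zero]
  have hρ2 : ∫ θ in (0:ℝ)..(2 * Real.pi), ρ θ ^ 2 = I0 - 2 * I1 + I2 := by
    have : (fun θ => ρ θ ^ 2) = fun θ => (p θ ^ 2 + 2 * (p θ * p2 θ)) + p2 θ ^ 2 := by
      rw [hρdef]; ext θ; ring
    rw [this, intervalIntegral.integral_add (ii _ (by fun_prop)) (ii _ (by fun_prop)),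
      intervalIntegral.integral_add (ii _ (by fun_prop)) (ii _ (by fun_prop)),
      intervalIntegral.integral_const_mul, m02]
    ring
  have hβ2 : ∫ θ in (0:ℝ)..(2 * Real.pi), ρβ θ ^ 2 = I1 - 2 * I2 + I3 := by
    have : (fun θ => ρβ θ ^ 2) = fun θ => (p1 θ ^ 2 + 2 * (p1 θ * p3 θ)) + p3 θ ^ 2 := by
      rw [hρβ]; ext θ; simp only [sq_abs]; ring
    rw [this, intervalIntegral.integral_add (ii _ (by fun_prop)) (ii _ (by fun_prop)),
      intervalIntegral.integral_add (ii _ (by fun_prop)) (ii _ (by fun_prop)),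
      intervalIntegral.integral_const_mul, m13]
    ring
  have hA' : A = (1 / 2) * (I0 - I1) := by
    rw [hA, intervalIntegral.integral_sub (ii _ (by fun_prop)) (ii _ (by fun_prop))]
  have w12 : I1 ≤ I2 := aux_w1 p1 p2 d1 c2 q1 z1
  have hAt' : |Atilde| = (1 / 2) * (I2 - I1) := by
    rw [hAt, intervalIntegral.integral_sub (ii _ (by fun_prop)) (ii _ (by fun_prop)),
      abs_of_nonpos (by linarith)]
    ring
  set a0 := J / (2 * Real.pi) with ha0
  have hJa : J = 2 * Real.pi * a0 := by rw [ha0]; field_simp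
  have shift : ∀ f : ℝ → ℝ, Continuous f → ∀ c : ℝ, ∫ x in (0:ℝ)..(2 * Real.pi), (f x - c) ^ 2 =
      (∫ x in (0:ℝ)..(2 * Real.pi), f x ^ 2) - 2 * c * (∫ x in (0:ℝ)..(2 * Real.pi), f x) + 2 * Real.pi * c ^ 2 := by
    intro f hf c
    have : (fun x => (f x - c) ^ 2) = fun x => (f x ^ 2 - 2 * c * f x) + c ^ 2 := by
      ext x; ring
    rw [this, intervalIntegral.integral_add (ii _ (by fun_prop)) (ii _ (by fun_prop)),
      intervalIntegral.integral_sub (ii _ (by fun_prop)) (ii _ (by fun_prop)),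
      intervalIntegral.integral_const_mul, intervalIntegral.integral_const]
    simp
  have dq : ∀ x, HasDerivAt (fun x => p x - a0) (p1 x) x := fun x => (d0 x).sub_const a0
  have hq0 : ∫ x in (0:ℝ)..(2 * Real.pi), (p x - a0) = 0 := by
    rw [intervalIntegral.integral_sub (ii _ (by fun_prop)) (ii _ (by fun_prop)), intervalIntegral.integral_const, ← hJ, hJa]
    simp
  have hqq : ∫ x in (0:ℝ)..(2 * Real.pi), (p x - a0) ^ 2 = I0 - J ^ 2 / (2 * Real.pi) := by
    rw [shift p c0, ← hJ, ← hI0, ha0]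
    field_simp
    ring
  have w01 := aux_w1 (fun x => p x - a0) p1 dq c1 (by simp only [q0]) hq0
  have wb := aux_w2 (fun x => p x - a0) p1 p2 dq d1 c2 (by simp only [q0]) q1
  rw [hqq] at w01 wb
  have wc := aux_w2 p1 p2 p3 d1 d2 c3 q1 q2
  have hρ2n : 0 ≤ I0 - 2 * I1 + I2 := by
    rw [← hρ2]; exact intervalIntegral.integral_nonneg h2pi.le fun x _ => sq_nonneg _
  have hR : 0 ≤ ∫ θ in (0:ℝ)..(2 * Real.pi), (ρ θ)⁻¹ :=
    intervalIntegral.integral_nonneg h2pi.le fun x _ => (inv_pos.2 (hρpos x)).le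
  have hJ0 : 0 ≤ J := by
    rw [← hLJ, hL]; exact intervalIntegral.integral_nonneg h2pi.le fun x _ => (hρpos x).le
  set D := I1 - (I0 - J ^ 2 / (2 * Real.pi)) with hD
  have hDa : D = I1 - I0 + 2 * Real.pi * a0 ^ 2 := by
    rw [hD, ha0]; field_simp; ring
  -- Bonnesen
  obtain ⟨e1, e2, m, hm, hmI⟩ := aux_bonn p p1 d0 c1 hper
  obtain ⟨g1, g2, k, hk, hkI⟩ := aux_bonn (fun x => - p x) (fun x => - p1 x) (fun x => (d0 x).neg) (by fun_prop)
    (by intro θ; simp only [hper])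
  rw [shift p c0, ← hJ, ← hI0] at hmI
  rw [shift (fun x => - p x) (by fun_prop), intervalIntegral.integral_neg] at hkI
  simp only [neg_sq] at hkI
  rw [← hJ, ← hI0, ← hI1] at hkI
  have hma : 2 * Real.pi * (m - a0) ^ 2 ≤ D := by
    rw [hJa] at hmI; rw [hDa]; linarith
  have hka : 2 * Real.pi * (k + a0) ^ 2 ≤ D := by
    rw [hJa] at hkI; rw [hDa]; linarith
  have hm0 : 0 ≤ m := by
    have hle : ∫ x in (0:ℝ)..(2 * Real.pi), (p x - e1 * Real.cos x - e2 * Real.sin x) ≤ ∫ x in (0:ℝ)..(2 * Real.pi), m :=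
      intervalIntegral.integral_mono_on h2pi.le (ii _ (by fun_prop)) (ii _ (by fun_prop)) fun x _ => hm x
    rw [intervalIntegral.integral_sub (ii _ (by fun_prop)) (ii _ (by fun_prop)),
      intervalIntegral.integral_sub (ii _ (by fun_prop)) (ii _ (by fun_prop)),
      intervalIntegral.integral_const_mul, intervalIntegral.integral_const_mul, integral_cos, integral_sin,
      intervalIntegral.integral_const, ← hJ] at hle
    simp at hle
    by_contra hneg
    push Not at hneg
    nlinarith
  obtain ⟨v1, v2⟩ := aux_geo p K hK ρe ρi hρe hρi e1 e2 m g1 g2 (-k) hm0 hm (by simpa using hk)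
  have hV : (ρe - ρi) ^ 2 ≤ 2 * D / Real.pi := by
    rw [le_div_iff₀ hpi]
    have s1 : (ρe - ρi) ^ 2 ≤ (m - -k) ^ 2 := by
      apply pow_le_pow_left₀ v1 v2
    have s2 : (m - -k) ^ 2 ≤ 2 * ((m - a0) ^ 2 + (k + a0) ^ 2) := by
      linarith [sq_nonneg ((m - a0) - (k + a0))]
    have s3 := mul_le_mul_of_nonneg_right (s1.trans s2) hpi.le
    linarith
  -- Popoviciu
  have hcomp : IsCompact (ρ '' Set.Icc (0:ℝ) (2 * Real.pi)) := isCompact_Icc.image cρ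
  have hMle : ∀ x ∈ Set.Icc (0:ℝ) (2 * Real.pi), ρ x ≤ ρM := fun x hx => by
    rw [hρM]; exact le_csSup hcomp.bddAbove ⟨x, hx, rfl⟩
  have hmle : ∀ x ∈ Set.Icc (0:ℝ) (2 * Real.pi), ρm ≤ ρ x := fun x hx => by
    rw [hρm]; exact csInf_le hcomp.bddBelow ⟨x, hx, rfl⟩
  have hpop : ∫ x in (0:ℝ)..(2 * Real.pi), (ρ x - (ρM + ρm) / 2) ^ 2 ≤ ∫ x in (0:ℝ)..(2 * Real.pi), (ρM - ρm) ^ 2 / 4 := by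
    refine intervalIntegral.integral_mono_on h2pi.le (ii _ (by fun_prop)) (ii _ (by fun_prop)) fun x hx => ?_
    have := mul_nonneg (sub_nonneg.2 (hMle x hx)) (sub_nonneg.2 (hmle x hx))
    linarith
  rw [shift ρ cρ, hρ2, ← hL, hLJ, intervalIntegral.integral_const, smul_eq_mul, sub_zero] at hpop
  have hM : 2 * D / Real.pi ≤ (ρM - ρm) ^ 2 := by
    rw [div_le_iff₀ hpi]
    have hja : J ^ 2 / (2 * Real.pi) = 2 * Real.pi * a0 ^ 2 := by rw [ha0]; field_simp
    rw [hja] at wb w01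
    have : 0 ≤ 2 * Real.pi * (a0 - (ρM + ρm) / 2) ^ 2 := by positivity
    rw [hJa] at hpop
    have hE : 6 * D ≤ (ρM - ρm) ^ 2 * Real.pi := by
      rw [hDa]; linarith
    have hD0 : 0 ≤ D := by rw [hDa]; linarith
    linarith
  rw [hW, hρ2, hLJ, hA', hAt', hβ2]
  exact aux_main J I0 I1 I2 I3 _ _ D _ α δ μ σ η lam ξ ζ hpi hR hη hξ hζ hlam hc1 hc2 hc3 hD
    (by rw [hD]; linarith) wb wc hρ2n hV hM
end
end

section
/- Let real parameters (α, δ, μ, σ, η, λ, ξ, ζ) satisfy η ≥ 0, ξ ≥ 0, ζ ≥ 0, λ ≤ 0, 2α + 4πδ + μ − 4ζ ≥ 0, 2α + σ − 2η − 4ζ ≥ 0, 6πα − πμ + 4πσ + 24πη + 4λ + 4ξ − 12πζ ≥ 0, and λ² + ξ² + ζ² > 0. If W = 0, where W = α∫₀^{2π}ρ(θ)²dθ + δL² + μA + σ|Ã| + η∫₀^{2π}ρ_β(θ)²dθ + λ(ρ_e − ρ_i)² + ξ(ρ_M − ρ_m)² + ζ∫₀^{2π}ρ(θ)⁻¹dθ,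 then K is a disk, i.e. there exist real numbers a₀, a₁, b₁ with p(θ) = a₀ + a₁ cos θ + b₁ sin θ for all θ. -/
open MeasureTheory

noncomputable section

def cf (f : ℝ → ℂ) (n : ℤ) : ℂ :=
  (1 / (2 * (Real.pi : ℂ))) * ∫ x in (0:ℝ)..(2 * Real.pi), Complex.exp (-(Complex.I * n * x)) * f x

lemma cf_parseval (f : ℝ → ℂ) (hf : Continuous f) :
    HasSum (fun n => ‖cf f n‖ ^ 2) ((2 * Real.pi)⁻¹ * ∫ x in (0:ℝ)..(2 * Real.pi), ‖f x‖ ^ 2) := by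
  have hab : (0:ℝ) < 2 * Real.pi := Real.two_pi_pos
  have hL2 : MemLp f 2 (volume.restrict (Set.Ioc 0 (2 * Real.pi))) := by
    obtain ⟨C, hC⟩ := (isCompact_Icc (a := (0:ℝ)) (b := 2 * Real.pi)).exists_bound_of_continuousOn hf.continuousOn
    refine MemLp.of_bound hf.aestronglyMeasurable C ?_
    filter_upwards [ae_restrict_mem measurableSet_Ioc] with x hx
    exact hC x (Set.Ioc_subset_Icc_self hx)
  have := hasSum_sq_fourierCoeffOn hab hL2
  simp only [sub_zero, smul_eq_mul] at this
  convert this using 4 with n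
  rw [fourierCoeffOn_eq_integral, cf]
  simp only [sub_zero, fourier_coe_apply, smul_eq_mul, Complex.real_smul]
  push_cast
  congr 1
  apply intervalIntegral.integral_congr
  intro x _
  have : (Real.pi : ℂ) ≠ 0 := by exact_mod_cast Real.pi_ne_zero
  simp only
  congr 2
  field_simp

lemma cf_deriv (f f' : ℝ → ℂ) (h : ∀ x, HasDerivAt f (f' x) x) (hc : Continuous f') (n : ℤ) :
    cf f' n = Complex.I * n * cf f n + (f (2 * Real.pi) - f 0) / (2 * Real.pi) := by
  have he : ∀ x : ℝ, HasDerivAt (fun x : ℝ => Complex.exp (-(Complex.I * n * x)))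
      (-(Complex.I * n) * Complex.exp (-(Complex.I * n * x))) x := by
    intro x
    have h1 : HasDerivAt (fun x : ℝ => -(Complex.I * n * (x:ℂ))) (-(Complex.I * n)) x := by
      have := ((Complex.ofRealCLM.hasDerivAt (x := x)).const_mul (-(Complex.I * n)))
      simpa using this
    have := h1.cexp
    convert this using 1
    ring
  have hfc : Continuous f := continuous_iff_continuousAt.2 fun x => (h x).continuousAt
  have hi := intervalIntegral.integral_mul_deriv_eq_deriv_mul (a := 0) (b := 2 * Real.pi)
    (fun x _ => he x) (fun x _ => h x)
    (Continuous.intervalIntegrable (by fun_prop) _ _) (hc.intervalIntegrable _ _)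
  have e1 : Complex.exp (-(Complex.I * n * ((2 * Real.pi : ℝ) : ℂ))) = 1 := by
    rw [Complex.exp_eq_one_iff]
    exact ⟨-n, by push_cast; ring⟩
  rw [cf, hi, e1, cf]
  simp only [mul_assoc, intervalIntegral.integral_const_mul]
  simp only [Complex.ofReal_zero, mul_zero, neg_zero, Complex.exp_zero]
  have : (Real.pi : ℂ) ≠ 0 := by exact_mod_cast Real.pi_ne_zero
  field_simp
  ring

lemma cf_pointwise (F : C(AddCircle (2 * Real.pi), ℂ)) (f : ℝ → ℂ)
    (hF : ∀ x ∈ Set.Ico (0:ℝ) (2 * Real.pi), F (x : AddCircle (2 * Real.pi)) = f x)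
    (hs : Summable (cf f)) (x : ℝ) :
    HasSum (fun n : ℤ => cf f n * Complex.exp (Complex.I * n * x))
      (F (x : AddCircle (2 * Real.pi))) := by
  have : Fact (0 < 2 * Real.pi) := ⟨Real.two_pi_pos⟩
  have hpi : (Real.pi : ℂ) ≠ 0 := by exact_mod_cast Real.pi_ne_zero
  have hc : fourierCoeff F = cf f := by
    ext n
    rw [fourierCoeff_eq_intervalIntegral _ _ 0, cf, zero_add, Complex.real_smul]
    push_cast
    congr 1
    rw [intervalIntegral.integral_of_le Real.two_pi_pos.le,
      intervalIntegral.integral_of_le Real.two_pi_pos.le,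
      ← integral_Ico_eq_integral_Ioc, ← integral_Ico_eq_integral_Ioc]
    apply setIntegral_congr_fun measurableSet_Ico
    intro y hy
    simp only [fourier_coe_apply, smul_eq_mul, hF y hy]
    congr 2
    push_cast
    field_simp
  have := has_pointwise_sum_fourier_series_of_summable (f := F) (by rw [hc]; exact hs) x
  rw [hc] at this
  convert this using 2 with n
  simp only [fourier_coe_apply, smul_eq_mul]
  congr 2
  push_cast
  field_simp

lemma cf_add (f h : ℝ → ℂ) (hf : Continuous f) (hh : Continuous h) (n : ℤ) :
    cf (fun x => f x + h x) n = cf f n + cf h n := by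
  simp only [cf, mul_add]
  rw [intervalIntegral.integral_add, mul_add]
  · exact Continuous.intervalIntegrable (by fun_prop) _ _
  · exact Continuous.intervalIntegrable (by fun_prop) _ _

lemma cf_const_mul (c : ℂ) (f : ℝ → ℂ) (n : ℤ) :
    cf (fun x => c * f x) n = c * cf f n := by
  simp only [cf]
  rw [← mul_assoc, mul_comm c, mul_assoc, ← intervalIntegral.integral_const_mul c]
  congr 2
  ext x
  ring

lemma hasDerivAt_ccos (x : ℝ) : HasDerivAt (fun x : ℝ => Complex.cos x) (-Complex.sin x) x := by
  simpa using (Complex.hasDerivAt_cos (x:ℂ)).comp_ofReal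

lemma hasDerivAt_csin (x : ℝ) : HasDerivAt (fun x : ℝ => Complex.sin x) (Complex.cos x) x := by
  simpa using (Complex.hasDerivAt_sin (x:ℂ)).comp_ofReal

lemma cf_cos (n : ℤ) : ((n:ℂ) ^ 2 - 1) * cf (fun x : ℝ => Complex.cos x) n = 0 := by
  have h1 := cf_deriv (fun x : ℝ => Complex.cos x) (fun x : ℝ => -Complex.sin x)
    hasDerivAt_ccos (by fun_prop) n
  have h2 := cf_deriv (fun x : ℝ => -Complex.sin x) (fun x : ℝ => (-1) * Complex.cos x)
    (fun x => by simpa using (hasDerivAt_csin x).fun_neg) (by fun_prop) n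
  rw [cf_const_mul, h1] at h2
  have e1 : Complex.cos (2 * Real.pi) = 1 := by
    have := Real.cos_two_pi
    exact_mod_cast congrArg Complex.ofReal this
  have e2 : Complex.sin (2 * Real.pi) = 0 := by
    have := Real.sin_two_pi
    exact_mod_cast congrArg Complex.ofReal this
  simp [e1, e2] at h2
  linear_combination h2 + (n:ℂ)^2 * cf (fun x : ℝ => Complex.cos x) n * Complex.I_sq

lemma cf_g (n : ℤ) : ((n:ℂ) ^ 2 - 1) ^ 2 * cf (fun x : ℝ => ((Real.pi : ℂ) - x) * Complex.sin x) n
    = -((n:ℂ) ^ 2 - 1) := by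
  have hid : ∀ x : ℝ, HasDerivAt (fun x : ℝ => (Real.pi : ℂ) - x) (-1) x := by
    intro x
    simpa using (Complex.ofRealCLM.hasDerivAt (x := x)).const_sub (Real.pi : ℂ)
  have h1 := cf_deriv (fun x : ℝ => ((Real.pi : ℂ) - x) * Complex.sin x)
    (fun x : ℝ => -Complex.sin x + ((Real.pi : ℂ) - x) * Complex.cos x)
    (fun x => by simpa using (hid x).fun_mul (hasDerivAt_csin x)) (by fun_prop) n
  have h2 := cf_deriv (fun x : ℝ => -Complex.sin x + ((Real.pi : ℂ) - x) * Complex.cos x)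
    (fun x : ℝ => (-1) * (((Real.pi : ℂ) - x) * Complex.sin x) + (-2) * Complex.cos x)
    (fun x => by
      have := (hasDerivAt_csin x).fun_neg.fun_add ((hid x).fun_mul (hasDerivAt_ccos x))
      exact this.congr_deriv (by ring)) (by fun_prop) n
  rw [cf_add _ _ (by fun_prop) (by fun_prop), cf_const_mul, cf_const_mul, h1] at h2
  have e1 : Complex.cos (2 * Real.pi) = 1 := by
    have := Real.cos_two_pi
    exact_mod_cast congrArg Complex.ofReal this
  have e2 : Complex.sin (2 * Real.pi) = 0 := by
    have := Real.sin_two_pi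
    exact_mod_cast congrArg Complex.ofReal this
  have hpi : (Real.pi : ℂ) ≠ 0 := by exact_mod_cast Real.pi_ne_zero
  have e3 : ((Real.pi : ℂ) - 2 * Real.pi - Real.pi) / (2 * Real.pi) = -1 := by
    field_simp
    ring
  simp [e1, e2] at h2
  have h3 := cf_cos n
  linear_combination ((n:ℂ)^2 - 1) * h2 + 2 * h3 + ((n:ℂ)^2 - 1) * (n:ℂ)^2 * cf (fun x : ℝ => ((Real.pi : ℂ) - x) * Complex.sin x) n * Complex.I_sq

lemma g_bound (y : ℝ) (h0 : 0 ≤ y) (h1 : y ≤ Real.pi) : y * Real.sin y ≤ 1.9 := by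
  have hp1 := Real.pi_gt_d4
  have hp2 := Real.pi_lt_d4
  have hs1 := Real.sin_le_one y
  have hs0 := Real.sin_nonneg_of_nonneg_of_le_pi h0 h1
  by_cases hy : y ≤ 1.9
  · nlinarith
  push Not at hy
  have hc : Real.sin y = Real.cos (y - Real.pi / 2) := by
    rw [Real.cos_sub_pi_div_two]
  obtain ⟨z, hz⟩ : ∃ z, z = y - Real.pi / 2 := ⟨_, rfl⟩
  have hz0 : 0 ≤ z := by linarith
  rw [← hz] at hc
  by_cases hz1 : z ≤ 1
  · have hb := (abs_le.1 (Real.cos_bound (x := z) (by rw [abs_of_nonneg hz0]; exact hz1))).2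
    rw [abs_of_nonneg hz0] at hb
    have hcu : Real.sin y ≤ 1 - z ^ 2 / 2 + z ^ 4 * (5 / 96) := by rw [hc]; linarith
    have hyu : y ≤ 1.5709 + z := by linarith
    have : y * Real.sin y ≤ (1.5709 + z) * (1 - z ^ 2 / 2 + z ^ 4 * (5 / 96)) :=
      mul_le_mul hyu hcu hs0 (by linarith)
    refine this.trans ?_
    have h4 : z ^ 4 ≤ z ^ 2 := by nlinarith [sq_nonneg z, mul_nonneg hz0 hz0, mul_nonneg (mul_nonneg hz0 hz0) (sub_nonneg.2 hz1)]
    have h6 : z ^ 4 * z ≤ z ^ 3 := by nlinarith [pow_nonneg hz0 3]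
    nlinarith [sq_nonneg (z - 0.46), mul_nonneg hz0 (sq_nonneg (z - 0.46)), mul_nonneg hz0 (sq_nonneg (z-0.5)), pow_nonneg hz0 3]
  · push Not at hz1
    have : Real.cos z ≤ Real.cos 1 := Real.cos_le_cos_of_nonneg_of_le_pi (by norm_num) (by linarith) hz1.le
    have h5 := Real.cos_one_le
    rw [hc]
    rw [hc] at hs0
    nlinarith

lemma int_sq_ge (n : ℤ) (h : (n:ℝ) ^ 2 ≠ 1) (h0 : n ≠ 0) : (4:ℝ) ≤ (n:ℝ) ^ 2 := by
  have h2 : n ≤ -2 ∨ n = -1 ∨ n = 0 ∨ n = 1 ∨ 2 ≤ n := by omega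
  rcases h2 with h2 | h2 | h2 | h2 | h2
  · have : (n:ℝ) ≤ -2 := by exact_mod_cast h2
    nlinarith
  · subst h2; norm_num at h
  · exact absurd h2 h0
  · subst h2; norm_num at h
  · have : (2:ℝ) ≤ n := by exact_mod_cast h2
    nlinarith

lemma g_exists : ∃ (G : ℝ → ℝ) (k : ℤ → ℂ), (∀ x, 0 ≤ G x) ∧ (∀ x, G x ≤ 1.9) ∧
    (∀ x : ℝ, HasSum (fun n : ℤ => k n * Complex.exp (Complex.I * n * x)) (G x)) ∧
    (∀ n : ℤ, (n:ℝ) ^ 2 ≠ 1 → k n = -(((n:ℝ) ^ 2 - 1)⁻¹ : ℝ)) := by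
  have : Fact (0 < 2 * Real.pi) := ⟨Real.two_pi_pos⟩
  have hcont : Continuous (fun x : ℝ => (Real.pi - x) * Real.sin x) := by fun_prop
  let Gr : AddCircle (2 * Real.pi) → ℝ :=
    AddCircle.liftIco (2 * Real.pi) 0 (fun x : ℝ => (Real.pi - x) * Real.sin x)
  have hGr : Continuous Gr := AddCircle.liftIco_continuous (by simp) hcont.continuousOn
  have hGv : ∀ x ∈ Set.Ico (0:ℝ) (2 * Real.pi), Gr (x : AddCircle (2 * Real.pi)) = (Real.pi - x) * Real.sin x := by
    intro x hx
    exact AddCircle.liftIco_coe_apply (by simpa using hx)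
  have hrep : ∀ z : AddCircle (2 * Real.pi), ∃ x ∈ Set.Ico (0:ℝ) (2 * Real.pi), (x : AddCircle (2 * Real.pi)) = z := by
    intro z
    have h := (AddCircle.equivIco (2 * Real.pi) 0 z).2
    refine ⟨(AddCircle.equivIco (2 * Real.pi) 0 z : ℝ), by simpa using h, ?_⟩
    exact AddCircle.coe_equivIco
  have hk : ∀ n : ℤ, (n:ℝ) ^ 2 ≠ 1 → cf (fun x : ℝ => ((Real.pi : ℂ) - x) * Complex.sin x) n = -(((n:ℝ) ^ 2 - 1)⁻¹ : ℝ) := by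
    intro n hn
    have h := cf_g n
    have hne : ((n:ℂ) ^ 2 - 1) ≠ 0 := by
      intro h0
      apply hn
      have : (n:ℂ) ^ 2 = 1 := by linear_combination h0
      exact_mod_cast this
    push_cast
    apply mul_left_cancel₀ (pow_ne_zero 2 hne)
    rw [h]
    field_simp
  let F : C(AddCircle (2 * Real.pi), ℂ) := ⟨fun z => (Gr z : ℂ), by fun_prop⟩
  have hsum : Summable (cf (fun x : ℝ => ((Real.pi : ℂ) - x) * Complex.sin x)) := by
    have hs : Summable (fun n : ℤ => 2 * (1 / (n:ℝ) ^ 2)) :=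
      (Real.summable_one_div_int_pow.2 (by norm_num)).mul_left 2
    refine Summable.of_norm_bounded_eventually hs ?_
    have hfin : ({-1, 0, 1} : Set ℤ).Finite := by simp
    refine hfin.subset ?_
    intro n hn
    by_contra hcon
    apply hn
    have h0 : n ≠ 0 := by rintro rfl; simp at hcon
    have h1 : (n:ℝ) ^ 2 ≠ 1 := by
      intro h1
      apply hcon
      have : n ^ 2 = 1 := by exact_mod_cast h1
      have h9 : (n - 1) * (n + 1) = 0 := by linear_combination this
      have h8 : n = 1 ∨ n = -1 := by
        rcases mul_eq_zero.1 h9 with h | h <;> omega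
      rcases h8 with h | h <;> simp [h]
    have h4 := int_sq_ge n h1 h0
    show ‖cf _ n‖ ≤ _
    rw [hk n h1, norm_neg, Complex.norm_real, Real.norm_eq_abs, abs_of_pos (inv_pos.2 (by linarith))]
    rw [← one_div, mul_one_div, div_le_div_iff₀ (by linarith) (by linarith)]
    linarith
  refine ⟨fun x => Gr x, cf (fun x : ℝ => ((Real.pi : ℂ) - x) * Complex.sin x), ?_, ?_, ?_, hk⟩
  · intro x
    obtain ⟨y, hy, hxy⟩ := hrep x
    simp only [← hxy, hGv y hy]
    rcases le_total y Real.pi with h | h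
    · exact mul_nonneg (by linarith) (Real.sin_nonneg_of_nonneg_of_le_pi hy.1 h)
    · refine mul_nonneg_of_nonpos_of_nonpos (by linarith) ?_
      have := Real.sin_nonneg_of_nonneg_of_le_pi (x := y - Real.pi) (by linarith) (by linarith [hy.2])
      rw [Real.sin_sub_pi] at this
      linarith
  · intro x
    obtain ⟨y, hy, hxy⟩ := hrep x
    simp only [← hxy, hGv y hy]
    rcases le_total y Real.pi with h | h
    · have := g_bound (Real.pi - y) (by linarith) (by linarith [hy.1])
      rwa [Real.sin_pi_sub] at this
    · have := g_bound (y - Real.pi) (by linarith) (by linarith [hy.2])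
      rw [Real.sin_sub_pi] at this
      linarith
  · intro x
    refine cf_pointwise F _ ?_ hsum x
    intro y hy
    show ((Gr y : ℝ) : ℂ) = _
    rw [hGv y hy]
    push_cast
    rfl


lemma exp_conj_mul (n : ℤ) (x y : ℝ) : Complex.exp (Complex.I * n * x) *
    (starRingEnd ℂ) (Complex.exp (Complex.I * n * y)) = Complex.exp (Complex.I * n * ((x - y : ℝ) : ℂ)) := by
  rw [← Complex.exp_conj, ← Complex.exp_add]
  congr 1
  simp
  ring

lemma key_ineq (p : ℝ → ℝ) (c : ℤ → ℂ)
    (hc : ∀ x : ℝ, HasSum (fun n : ℤ => c n * Complex.exp (Complex.I * n * x)) (p x))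
    (z : ℤ → ℝ) (Z : ℝ) (hz : HasSum z Z) (hz0 : z 0 = 0)
    (hzn : ∀ n : ℤ, n ≠ 0 → z n = ((n:ℝ) ^ 2 - 1) * ‖c n‖ ^ 2) (t : ℝ) (ht : 0 < t) :
    ∃ A B : ℝ, ∀ (ι : Type) (_ : Fintype ι) (w θ φ : ι → ℝ), (∀ i, 0 ≤ w i) → ∑ i, w i = 1 →
      ∑ i, w i * (p (θ i) - p (φ i)) ≤ (t * Z + 3.8 / t) / 2
        + A * ‖((∑ i, w i * (Real.cos (θ i) - Real.cos (φ i)) : ℝ) : ℂ) + (∑ i, w i * (Real.sin (θ i) - Real.sin (φ i)) : ℝ) * Complex.I‖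
        + B * ‖((∑ i, w i * (Real.cos (θ i) - Real.cos (φ i)) : ℝ) : ℂ) + (∑ i, w i * (Real.sin (θ i) - Real.sin (φ i)) : ℝ) * Complex.I‖ ^ 2 := by
  obtain ⟨G, k, hG0, hG1, hGs, hk⟩ := g_exists
  refine ⟨‖c 1‖ + ‖c (-1)‖, ((k 1).re + (k (-1)).re) / (2 * t), ?_⟩
  intro ι _ w θ φ hw hw1
  obtain ⟨d, hd⟩ : ∃ d : ℤ → ℂ, d = fun n : ℤ => ∑ i, (w i : ℂ) *
    (Complex.exp (Complex.I * n * (θ i)) - Complex.exp (Complex.I * n * (φ i))) := ⟨_, rfl⟩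
  have hd1 : d 1 = ((∑ i, w i * (Real.cos (θ i) - Real.cos (φ i)) : ℝ) : ℂ) + (∑ i, w i * (Real.sin (θ i) - Real.sin (φ i)) : ℝ) * Complex.I := by
    rw [hd]
    push_cast
    rw [Finset.sum_mul, ← Finset.sum_add_distrib]
    apply Finset.sum_congr rfl
    intro i _
    have : ∀ x : ℂ, Complex.exp (Complex.I * 1 * x) = Complex.cos x + Complex.sin x * Complex.I := by
      intro x
      rw [← Complex.exp_mul_I]
      congr 1
      ring
    rw [this, this]
    ring
  have hd1' : ‖d (-1)‖ = ‖d 1‖ := by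
    have : d (-1) = (starRingEnd ℂ) (d 1) := by
      rw [hd]
      simp only [map_sum, map_mul, map_sub, ← Complex.exp_conj, Complex.conj_ofReal, Complex.conj_I]
      simp
    rw [this, Complex.norm_conj]
  have hd0 : d 0 = 0 := by
    rw [hd]; simp
  rw [← hd1]
  have h1 : HasSum (fun n : ℤ => c n * d n) ((∑ i, w i * (p (θ i) - p (φ i)) : ℝ) : ℂ) := by
    have : HasSum (fun n : ℤ => ∑ i, (w i : ℂ) * (c n * Complex.exp (Complex.I * n * (θ i)) - c n * Complex.exp (Complex.I * n * (φ i))))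
        (∑ i, (w i : ℂ) * ((p (θ i) : ℂ) - p (φ i))) :=
      hasSum_sum fun i _ => ((hc (θ i)).sub (hc (φ i))).mul_left _
    convert this using 1
    · ext n
      rw [hd]
      simp only [Finset.mul_sum]
      apply Finset.sum_congr rfl
      intro i _
      ring
    · push_cast
      rfl
  have h1r := Complex.hasSum_re h1
  rw [Complex.ofReal_re] at h1r
  obtain ⟨Q, hQ⟩ : ∃ Q : ℝ, Q = ∑ i, ∑ j, w i * w j * (G (θ i - θ j) - G (θ i - φ j) - G (φ i - θ j) + G (φ i - φ j)) := ⟨_, rfl⟩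
  have hQb : -3.8 ≤ Q := by
    have hsum : ∑ i, ∑ j, w i * w j * (-3.8) = (-3.8 : ℝ) := by
      simp only [← Finset.sum_mul, ← Finset.mul_sum, hw1]
      norm_num
    rw [hQ, ← hsum]
    refine Finset.sum_le_sum fun i _ => Finset.sum_le_sum fun j _ => ?_
    refine mul_le_mul_of_nonneg_left ?_ (mul_nonneg (hw i) (hw j))
    linarith [hG0 (θ i - θ j), hG0 (φ i - φ j), hG1 (θ i - φ j), hG1 (φ i - θ j)]
  have h2 : HasSum (fun n : ℤ => k n * (‖d n‖ ^ 2 : ℝ)) (Q : ℂ) := by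
    have : HasSum (fun n : ℤ => ∑ i, ∑ j, (w i * w j : ℂ) * (k n * Complex.exp (Complex.I * n * ((θ i - θ j : ℝ) : ℂ))
        - k n * Complex.exp (Complex.I * n * ((θ i - φ j : ℝ) : ℂ)) - k n * Complex.exp (Complex.I * n * ((φ i - θ j : ℝ) : ℂ))
        + k n * Complex.exp (Complex.I * n * ((φ i - φ j : ℝ) : ℂ))))
        (∑ i, ∑ j, (w i * w j : ℂ) * ((G (θ i - θ j) : ℂ) - G (θ i - φ j) - G (φ i - θ j) + G (φ i - φ j))) :=
      hasSum_sum fun i _ => hasSum_sum fun j _ => (((((hGs _).sub (hGs _)).sub (hGs _)).add (hGs _))).mul_left _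
    convert this using 1
    · ext n
      have e : ((‖d n‖ ^ 2 : ℝ) : ℂ) = d n * (starRingEnd ℂ) (d n) := by
        rw [Complex.mul_conj, Complex.normSq_eq_norm_sq]
      rw [e, hd]
      simp only [map_sum, map_mul, map_sub, Complex.conj_ofReal, Finset.sum_mul_sum]
      simp only [Finset.mul_sum]
      refine Finset.sum_congr rfl fun i _ => Finset.sum_congr rfl fun j _ => ?_
      simp only [← exp_conj_mul]
      ring
    · rw [hQ]
      push_cast
      rfl
  have h2r := Complex.hasSum_re h2
  rw [Complex.ofReal_re] at h2r
  simp only [Complex.re_mul_ofReal] at h2r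
  have h3 : HasSum (fun n : ℤ => if n = 1 ∨ n = -1 then ‖c n‖ * ‖d n‖ + (k n).re * ‖d n‖ ^ 2 / (2 * t) else 0)
      (∑ n ∈ ({1, -1} : Finset ℤ), if n = 1 ∨ n = -1 then ‖c n‖ * ‖d n‖ + (k n).re * ‖d n‖ ^ 2 / (2 * t) else 0) := by
    apply hasSum_sum_of_ne_finset_zero
    intro n hn
    simp at hn
    simp [hn]
  have h4 := ((hz.mul_left (t / 2)).sub (h2r.mul_left (1 / (2 * t)))).add h3
  have h5 := hasSum_le (fun n => ?_) h1r h4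
  · refine h5.trans ?_
    rw [Finset.sum_pair (by norm_num)]
    simp only [true_or, or_true, if_true, hd1']
    have : (1 / (2 * t)) * (-3.8) ≤ (1 / (2 * t)) * Q := mul_le_mul_of_nonneg_left hQb (by positivity)
    have e2 : (t * Z + 3.8 / t) / 2 = t / 2 * Z - (1 / (2 * t)) * (-3.8) := by
      field_simp
      ring
    rw [e2]
    have e3 : ((k 1).re + (k (-1)).re) / (2 * t) * ‖d 1‖ ^ 2 = (k 1).re * ‖d 1‖ ^ 2 / (2 * t) + (k (-1)).re * ‖d 1‖ ^ 2 / (2 * t) := by ring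
    rw [e3]
    linarith
  · have hre : (c n * d n).re ≤ ‖c n‖ * ‖d n‖ := by
      rw [← norm_mul]; exact Complex.re_le_norm _
    by_cases hn0 : n = 0
    · subst hn0
      simp [hd0, hz0]
    by_cases hn1 : n = 1 ∨ n = -1
    · rw [if_pos hn1]
      have hzz : z n = 0 := by
        rw [hzn n hn0]
        rcases hn1 with h | h <;> subst h <;> norm_num
      rw [hzz]
      refine hre.trans (le_of_eq ?_)
      ring
    · rw [if_neg hn1]
      have hn2 : (n:ℝ) ^ 2 ≠ 1 := by
        intro h
        apply hn1
        have h9 : (n - 1) * (n + 1) = 0 := by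
          have : n ^ 2 = 1 := by exact_mod_cast h
          linear_combination this
        rcases mul_eq_zero.1 h9 with h | h <;> omega
      have h4 := int_sq_ge n hn2 hn0
      rw [hzn n hn0, hk n hn2]
      refine hre.trans ?_
      obtain ⟨m, hm⟩ : ∃ m, m = (n:ℝ) ^ 2 - 1 := ⟨_, rfl⟩
      have hm0 : 0 < m := by linarith
      rw [← hm]
      simp only [Complex.neg_re, Complex.ofReal_re]
      have : t / 2 * (m * ‖c n‖ ^ 2) - 1 / (2 * t) * (-m⁻¹ * ‖d n‖ ^ 2) + 0 - ‖c n‖ * ‖d n‖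
        = (t * m * ‖c n‖ - ‖d n‖) ^ 2 / (2 * t * m) := by
        field_simp
        ring
      have h0 : 0 ≤ (t * m * ‖c n‖ - ‖d n‖) ^ 2 / (2 * t * m) := by positivity
      linarith


lemma annulus (p : ℝ → ℝ) (c : ℤ → ℂ)
    (hc : ∀ x : ℝ, HasSum (fun n : ℤ => c n * Complex.exp (Complex.I * n * x)) (p x))
    (z : ℤ → ℝ) (Z : ℝ) (hz : HasSum z Z) (hz0 : z 0 = 0)
    (hzn : ∀ n : ℤ, n ≠ 0 → z n = ((n:ℝ) ^ 2 - 1) * ‖c n‖ ^ 2) (t : ℝ) (ht : 0 < t)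
    (T : ℝ) (hT : 0 < T) (hT2 : (t * Z + 3.8 / t) / 2 < T) :
    ∃ a b : ℝ, ∀ θ φ : ℝ, (p θ + a * Real.cos θ + b * Real.sin θ)
      - (p φ + a * Real.cos φ + b * Real.sin φ) ≤ T := by
  obtain ⟨A, B, hAB⟩ := key_ineq p c hc z Z hz hz0 hzn t ht
  let S : Set (ℝ × ℝ × ℝ) := Set.range fun q : ℝ × ℝ =>
    (Real.cos q.1 - Real.cos q.2, Real.sin q.1 - Real.sin q.2, p q.1 - p q.2)
  let C' : Set (ℝ × ℝ × ℝ) := {v | v.2.2 ≤ (t * Z + 3.8 / t) / 2 + A * ‖(v.1 : ℂ) + (v.2.1 : ℂ) * Complex.I‖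
    + B * ‖(v.1 : ℂ) + (v.2.1 : ℂ) * Complex.I‖ ^ 2}
  have hcl : IsClosed C' := by
    apply isClosed_le <;> fun_prop
  have hsub : convexHull ℝ S ⊆ C' := by
    intro v hv
    rw [mem_convexHull_iff_exists_fintype] at hv
    obtain ⟨ι, _, w, zz, hw, hw1, hzz, hsum⟩ := hv
    choose q hq using hzz
    have := hAB ι inferInstance w (fun i => (q i).1) (fun i => (q i).2) hw hw1
    have e1 : v.1 = ∑ i, w i * (Real.cos (q i).1 - Real.cos (q i).2) := by
      rw [← hsum, Prod.fst_sum]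
      refine Finset.sum_congr rfl fun i _ => ?_
      rw [← hq i]; simp
    have e2 : v.2.1 = ∑ i, w i * (Real.sin (q i).1 - Real.sin (q i).2) := by
      rw [← hsum, Prod.snd_sum, Prod.fst_sum]
      refine Finset.sum_congr rfl fun i _ => ?_
      rw [← hq i]; simp
    have e3 : v.2.2 = ∑ i, w i * (p (q i).1 - p (q i).2) := by
      rw [← hsum, Prod.snd_sum, Prod.snd_sum]
      refine Finset.sum_congr rfl fun i _ => ?_
      rw [← hq i]; simp
    rw [← e1, ← e2, ← e3] at this
    exact this
  have hsub2 : closure (convexHull ℝ S) ⊆ C' := closure_minimal hsub hcl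
  have hnot : ((0, 0, T) : ℝ × ℝ × ℝ) ∉ closure (convexHull ℝ S) := by
    intro h
    have := hsub2 h
    simp [C'] at this
    linarith
  obtain ⟨f, u, hf, hu⟩ := geometric_hahn_banach_closed_point (convex_convexHull ℝ S).closure
    isClosed_closure hnot
  have hf' : ∀ θ φ : ℝ, f (Real.cos θ - Real.cos φ, Real.sin θ - Real.sin φ, p θ - p φ) < f (0, 0, T) := by
    intro θ φ
    refine (hf _ (subset_closure (subset_convexHull ℝ S ⟨(θ, φ), rfl⟩))).trans hu
  have hlin : ∀ x y s : ℝ, f (x, y, s) = x * f (1, 0, 0) + y * f (0, 1, 0) + s * f (0, 0, 1) := by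
    intro x y s
    have : ((x, y, s) : ℝ × ℝ × ℝ) = x • (1, 0, 0) + y • (0, 1, 0) + s • (0, 0, 1) := by
      simp
    rw [this]
    simp only [map_add, map_smul, smul_eq_mul]
  have hγ : 0 < f (0, 0, 1) := by
    have := hf' 0 0
    rw [hlin, hlin 0 0 T] at this
    simp at this
    exact (pos_iff_pos_of_mul_pos this).1 hT
  refine ⟨f (1, 0, 0) / f (0, 0, 1), f (0, 1, 0) / f (0, 0, 1), ?_⟩
  intro θ φ
  have := hf' θ φ
  rw [hlin, hlin 0 0 T] at this
  refine le_of_mul_le_mul_right ?_ hγ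
  have e : ((p θ + f (1, 0, 0) / f (0, 0, 1) * Real.cos θ + f (0, 1, 0) / f (0, 0, 1) * Real.sin θ)
      - (p φ + f (1, 0, 0) / f (0, 0, 1) * Real.cos φ + f (0, 1, 0) / f (0, 0, 1) * Real.sin φ)) * f (0, 0, 1)
      = (Real.cos θ - Real.cos φ) * f (1, 0, 0) + (Real.sin θ - Real.sin φ) * f (0, 1, 0)
        + (p θ - p φ) * f (0, 0, 1) := by
    field_simp
    ring
  rw [e]
  linarith

lemma exists_dir (x y : ℝ) : ∃ θ : ℝ, x * Real.cos θ + y * Real.sin θ = Real.sqrt (x ^ 2 + y ^ 2) := by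
  refine ⟨Complex.arg ⟨x, y⟩, ?_⟩
  have h1 := Complex.norm_mul_cos_arg ⟨x, y⟩
  have h2 := Complex.norm_mul_sin_arg ⟨x, y⟩
  have h3 : ‖(⟨x, y⟩ : ℂ)‖ = Real.sqrt (x ^ 2 + y ^ 2) := by
    rw [Complex.norm_def, Complex.normSq_mk]
    congr 1
    ring
  simp only at h1 h2
  rw [h3] at h1 h2
  set s := Real.sqrt (x ^ 2 + y ^ 2)
  set θ := Complex.arg ⟨x, y⟩
  have : Real.sin θ ^ 2 + Real.cos θ ^ 2 = 1 := Real.sin_sq_add_cos_sq θ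
  calc x * Real.cos θ + y * Real.sin θ = (s * Real.cos θ) * Real.cos θ + (s * Real.sin θ) * Real.sin θ := by rw [h1, h2]
    _ = s * (Real.sin θ ^ 2 + Real.cos θ ^ 2) := by ring
    _ = s := by rw [this, mul_one]

lemma dir_le (x y θ : ℝ) : x * Real.cos θ + y * Real.sin θ ≤ Real.sqrt (x ^ 2 + y ^ 2) := by
  apply Real.le_sqrt_of_sq_le
  nlinarith [sq_nonneg (x * Real.sin θ - y * Real.cos θ), Real.sin_sq_add_cos_sq θ]

lemma geom (p : ℝ → ℝ) (K : Set (EuclideanSpace ℝ (Fin 2)))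
    (hK : K = {x | ∀ θ : ℝ, x 0 * Real.cos θ + x 1 * Real.sin θ ≤ p θ})
    (ρe ρi : ℝ)
    (hρe : ρe = sInf {r : ℝ | 0 ≤ r ∧ ∃ c, K ⊆ Metric.closedBall c r})
    (hρi : ρi = sSup {r : ℝ | 0 ≤ r ∧ ∃ c, Metric.closedBall c r ⊆ K})
    (T a b : ℝ) (hT : 0 ≤ T)
    (h : ∀ θ φ : ℝ, (p θ + a * Real.cos θ + b * Real.sin θ)
      - (p φ + a * Real.cos φ + b * Real.sin φ) ≤ T) :
    (ρe - ρi) ^ 2 ≤ T ^ 2 := by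
  obtain ⟨H, hH⟩ : ∃ H : ℝ → ℝ, H = fun θ => p θ + a * Real.cos θ + b * Real.sin θ := ⟨_, rfl⟩
  have hHH : ∀ θ φ, H θ - H φ ≤ T := by rw [hH]; exact h
  have hba : BddAbove (Set.range H) := ⟨H 0 + T, by rintro _ ⟨θ, rfl⟩; linarith [hHH θ 0]⟩
  have hbb : BddBelow (Set.range H) := ⟨H 0 - T, by rintro _ ⟨θ, rfl⟩; linarith [hHH 0 θ]⟩
  obtain ⟨R, hR⟩ : ∃ R, R = sSup (Set.range H) := ⟨_, rfl⟩
  obtain ⟨r, hr⟩ : ∃ r, r = sInf (Set.range H) := ⟨_, rfl⟩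
  have hRle : ∀ θ, H θ ≤ R := fun θ => by rw [hR]; exact le_csSup hba ⟨θ, rfl⟩
  have hrle : ∀ θ, r ≤ H θ := fun θ => by rw [hr]; exact csInf_le hbb ⟨θ, rfl⟩
  have hRr : R ≤ r + T := by
    rw [hR]
    apply csSup_le (Set.range_nonempty _)
    rintro _ ⟨θ, rfl⟩
    have : H θ - T ≤ r := by
      rw [hr]
      apply le_csInf (Set.range_nonempty _)
      rintro _ ⟨φ, rfl⟩
      linarith [hHH θ φ]
    linarith
  have hdist : ∀ (x c : EuclideanSpace ℝ (Fin 2)), dist x c = Real.sqrt ((x 0 - c 0) ^ 2 + (x 1 - c 1) ^ 2) := by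
    intro x c
    rw [EuclideanSpace.dist_eq]
    simp [Fin.sum_univ_two, Real.dist_eq, sq_abs]
  have hRmem : max R 0 ∈ {r : ℝ | 0 ≤ r ∧ ∃ c, K ⊆ Metric.closedBall c r} := by
    refine ⟨le_max_right _ _, !₂[-a, -b], ?_⟩
    intro x hx
    rw [hK] at hx
    rw [Metric.mem_closedBall, hdist]
    refine le_trans ?_ (le_max_left _ _)
    obtain ⟨θ, hθ⟩ := exists_dir (x 0 - (-a)) (x 1 - (-b))
    simp only [Matrix.cons_val_zero, Matrix.cons_val_one]
    rw [← hθ]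
    have h1 := hx θ
    have h2 := hRle θ
    rw [hH] at h2
    simp only at h2
    linarith
  have he1 : ρe ≤ max R 0 := by
    rw [hρe]
    exact csInf_le ⟨0, fun s hs => hs.1⟩ hRmem
  have he0 : 0 ≤ ρe := by
    rw [hρe]
    exact Real.sInf_nonneg fun s hs => hs.1
  have hi0 : 0 ≤ ρi := by
    rw [hρi]
    exact Real.sSup_nonneg fun s hs => hs.1
  have hshift : ∀ (c : EuclideanSpace ℝ (Fin 2)) (s e : ℝ), 0 ≤ s → e ^ 2 = 1 → !₂[c 0 + e * s, c 1] ∈ Metric.closedBall c s := by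
    intro c s e hs he
    rw [Metric.mem_closedBall, hdist]
    simp [mul_pow, he, Real.sqrt_sq hs]
  have hi1 : max r 0 ≤ ρi := by
    refine max_le ?_ hi0
    by_cases hr0 : 0 ≤ r
    · rw [hρi]
      refine le_csSup ⟨(p 0 + p Real.pi) / 2, ?_⟩ ⟨hr0, !₂[-a, -b], ?_⟩
      · rintro s ⟨hs, c, hcs⟩
        have m1 := hcs (hshift c s 1 hs (by norm_num))
        have m2 := hcs (hshift c s (-1) hs (by norm_num))
        rw [hK] at m1 m2
        have m1 := m1 0
        have m2 := m2 Real.pi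
        simp at m1 m2
        linarith
      · intro x hx
        rw [Metric.mem_closedBall, hdist] at hx
        rw [hK]
        intro θ
        have h2 := hrle θ
        rw [hH] at h2
        simp only at h2
        have h3 := dir_le (x 0 - (-a)) (x 1 - (-b)) θ
        simp only [Matrix.cons_val_zero, Matrix.cons_val_one] at hx
        linarith
    · linarith
  have hie : ρi ≤ ρe := by
    rw [hρi]
    refine Real.sSup_le ?_ he0
    rintro s ⟨hs, c, hcs⟩
    rw [hρe]
    refine le_csInf ⟨_, hRmem⟩ ?_
    rintro s' ⟨hs', c', hcs'⟩
    have m1 := hcs' (hcs (hshift c s 1 hs (by norm_num)))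
    have m2 := hcs' (hcs (hshift c s (-1) hs (by norm_num)))
    rw [Metric.mem_closedBall, hdist] at m1 m2
    simp only [Matrix.cons_val_zero, Matrix.cons_val_one] at m1 m2
    have n1 := (dir_le _ _ 0).trans m1
    have n2 := (dir_le _ _ Real.pi).trans m2
    simp at n1 n2
    linarith
  have hD : ρe - ρi ≤ T := by
    have : max R 0 ≤ max r 0 + T := max_le (by linarith [le_max_left r 0]) (by linarith [le_max_right r 0])
    linarith
  apply pow_le_pow_left₀ (by linarith) hD


lemma cf_parsevalR (f : ℝ → ℝ) (hf : Continuous f) :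
    HasSum (fun n => ‖cf (fun x => (f x : ℂ)) n‖ ^ 2)
      ((2 * Real.pi)⁻¹ * ∫ x in (0:ℝ)..(2 * Real.pi), f x ^ 2) := by
  have := cf_parseval (fun x => (f x : ℂ)) (by fun_prop)
  simpa [Complex.norm_real, sq_abs] using this

lemma cf_derivR (f f' : ℝ → ℝ) (h : ∀ x, HasDerivAt f (f' x) x) (hc : Continuous f')
    (hper : ∀ x, f (x + 2 * Real.pi) = f x) (n : ℤ) :
    cf (fun x => (f' x : ℂ)) n = Complex.I * n * cf (fun x => (f x : ℂ)) n := by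
  have h1 := cf_deriv (fun x => (f x : ℂ)) (fun x => (f' x : ℂ)) (fun x => (h x).ofReal_comp)
    (by fun_prop) n
  have h2 := hper 0
  rw [zero_add] at h2
  rw [h1, h2]
  simp

lemma per_deriv (f f' : ℝ → ℝ) (h : ∀ x, HasDerivAt f (f' x) x)
    (hper : ∀ x, f (x + 2 * Real.pi) = f x) (x : ℝ) : f' (x + 2 * Real.pi) = f' x := by
  have h1 := (h (x + 2 * Real.pi)).comp_add_const x (2 * Real.pi)
  have h2 : (fun x => f (x + 2 * Real.pi)) = f := funext hper
  rw [h2] at h1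
  exact h1.unique (h x)

lemma pkg (p p1 p2 p3 : ℝ → ℝ) (h0 : ∀ x, HasDerivAt p (p1 x) x) (h1 : ∀ x, HasDerivAt p1 (p2 x) x)
    (h2 : ∀ x, HasDerivAt p2 (p3 x) x) (h3 : Continuous p3)
    (hper : ∀ x, p (x + 2 * Real.pi) = p x) :
    ∃ c : ℤ → ℂ, (∀ x : ℝ, HasSum (fun n : ℤ => c n * Complex.exp (Complex.I * n * x)) (p x)) ∧
    HasSum (fun n : ℤ => ‖c n‖ ^ 2) ((2 * Real.pi)⁻¹ * ∫ x in (0:ℝ)..(2 * Real.pi), p x ^ 2) ∧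
    HasSum (fun n : ℤ => (n:ℝ) ^ 2 * ‖c n‖ ^ 2) ((2 * Real.pi)⁻¹ * ∫ x in (0:ℝ)..(2 * Real.pi), p1 x ^ 2) ∧
    HasSum (fun n : ℤ => (n:ℝ) ^ 4 * ‖c n‖ ^ 2) ((2 * Real.pi)⁻¹ * ∫ x in (0:ℝ)..(2 * Real.pi), p2 x ^ 2) ∧
    HasSum (fun n : ℤ => ((n:ℝ) ^ 2 - 1) ^ 2 * ‖c n‖ ^ 2)
      ((2 * Real.pi)⁻¹ * ∫ x in (0:ℝ)..(2 * Real.pi), (p x + p2 x) ^ 2) ∧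
    HasSum (fun n : ℤ => (n:ℝ) ^ 2 * ((n:ℝ) ^ 2 - 1) ^ 2 * ‖c n‖ ^ 2)
      ((2 * Real.pi)⁻¹ * ∫ x in (0:ℝ)..(2 * Real.pi), (p1 x + p3 x) ^ 2) ∧
    ‖c 0‖ ^ 2 = ((2 * Real.pi)⁻¹ * ∫ x in (0:ℝ)..(2 * Real.pi), (p x + p2 x)) ^ 2 := by
  have c0 : Continuous p := continuous_iff_continuousAt.2 fun x => (h0 x).continuousAt
  have c1 : Continuous p1 := continuous_iff_continuousAt.2 fun x => (h1 x).continuousAt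
  have c2 : Continuous p2 := continuous_iff_continuousAt.2 fun x => (h2 x).continuousAt
  have hp1 := per_deriv p p1 h0 hper
  have hp2 := per_deriv p1 p2 h1 hp1
  obtain ⟨c, hc⟩ : ∃ c : ℤ → ℂ, c = cf (fun x => (p x : ℂ)) := ⟨_, rfl⟩
  have d1 : ∀ n : ℤ, cf (fun x => (p1 x : ℂ)) n = Complex.I * n * c n := by
    intro n; rw [hc]; exact cf_derivR p p1 h0 c1 hper n
  have d2 : ∀ n : ℤ, cf (fun x => (p2 x : ℂ)) n = -(n:ℂ) ^ 2 * c n := by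
    intro n; rw [cf_derivR p1 p2 h1 c2 hp1 n, d1]
    linear_combination (n:ℂ) ^ 2 * c n * Complex.I_sq
  have d3 : ∀ n : ℤ, cf (fun x => (p3 x : ℂ)) n = -Complex.I * (n:ℂ) ^ 3 * c n := by
    intro n; rw [cf_derivR p2 p3 h2 h3 hp2 n, d2]
    ring
  have dρ : ∀ n : ℤ, cf (fun x => ((p x + p2 x : ℝ) : ℂ)) n = (1 - (n:ℝ) ^ 2 : ℝ) * c n := by
    intro n
    have : (fun x => ((p x + p2 x : ℝ) : ℂ)) = fun x => (p x : ℂ) + (p2 x : ℂ) := by ext x; push_cast; rfl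
    rw [this, cf_add _ _ (by fun_prop) (by fun_prop), d2, ← hc]
    push_cast
    ring
  have dβ : ∀ n : ℤ, cf (fun x => ((p1 x + p3 x : ℝ) : ℂ)) n = Complex.I * ((n:ℝ) * (1 - (n:ℝ) ^ 2) : ℝ) * c n := by
    intro n
    have : (fun x => ((p1 x + p3 x : ℝ) : ℂ)) = fun x => (p1 x : ℂ) + (p3 x : ℂ) := by ext x; push_cast; rfl
    rw [this, cf_add _ _ (by fun_prop) (by fun_prop), d1, d3]
    push_cast
    ring
  have s1 : HasSum (fun n : ℤ => (n:ℝ) ^ 2 * ‖c n‖ ^ 2) ((2 * Real.pi)⁻¹ * ∫ x in (0:ℝ)..(2 * Real.pi), p1 x ^ 2) := by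
    convert cf_parsevalR p1 c1 using 2 with n
    rw [d1]
    simp [mul_pow]
  refine ⟨c, ?_, ?_, s1, ?_, ?_, ?_, ?_⟩
  · have hs : Summable (cf (fun x => (p x : ℂ))) := by
      have hs : Summable (fun n : ℤ => (n:ℝ) ^ 2 * ‖c n‖ ^ 2 + (1 / (n:ℝ) ^ 2)) :=
        s1.summable.add (Real.summable_one_div_int_pow.2 (by norm_num))
      rw [← hc]
      refine Summable.of_norm_bounded_eventually hs ?_
      have hfin : ({0} : Set ℤ).Finite := by simp
      refine hfin.subset ?_
      intro n hn
      by_contra hcon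
      apply hn
      have h0 : (n:ℝ) ≠ 0 := by
        intro h
        apply hcon
        have : n = 0 := by exact_mod_cast h
        simp [this]
      show ‖c n‖ ≤ (n:ℝ) ^ 2 * ‖c n‖ ^ 2 + (1 / (n:ℝ) ^ 2)
      have e : (n:ℝ) ^ 2 * ‖c n‖ ^ 2 + (1 / (n:ℝ) ^ 2) - 2 * ‖c n‖ = (n * ‖c n‖ - 1 / n) ^ 2 := by
        field_simp
        ring
      nlinarith [sq_nonneg (n * ‖c n‖ - 1 / n), norm_nonneg (c n)]
    have hP : Function.Periodic (fun x => (p x : ℂ)) (2 * Real.pi) := fun x => by simp [hper x]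
    let F : C(AddCircle (2 * Real.pi), ℂ) := ⟨hP.lift, continuous_coinduced_dom.mpr (by
      show Continuous (fun x : ℝ => hP.lift (x : AddCircle (2 * Real.pi)))
      simp only [Function.Periodic.lift_coe]
      fun_prop)⟩
    have hF : ∀ x : ℝ, F (x : AddCircle (2 * Real.pi)) = p x := fun x => Function.Periodic.lift_coe hP x
    intro x
    have := cf_pointwise F (fun x => (p x : ℂ)) (fun x _ => hF x) hs x
    rw [hF, ← hc] at this
    exact this
  · rw [hc]; exact cf_parsevalR p c0
  · convert cf_parsevalR p2 c2 using 2 with n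
    rw [d2]
    simp [mul_pow, ← pow_mul]
  · convert cf_parsevalR (fun x => p x + p2 x) (by fun_prop) using 2 with n
    rw [dρ, norm_mul, mul_pow, Complex.norm_real, Real.norm_eq_abs, sq_abs]
    ring
  · convert cf_parsevalR (fun x => p1 x + p3 x) (by fun_prop) using 2 with n
    rw [dβ, norm_mul, norm_mul, mul_pow, mul_pow, Complex.norm_real, Real.norm_eq_abs, sq_abs, Complex.norm_I]
    ring
  · have h := dρ 0
    simp only [cf] at h
    simp at h
    rw [← h]
    have e : ∫ x in (0:ℝ)..(2 * Real.pi), ((p x : ℂ) + (p2 x : ℂ)) = ((∫ x in (0:ℝ)..(2 * Real.pi), (p x + p2 x) : ℝ) : ℂ) := by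
      rw [← intervalIntegral.integral_ofReal]
      push_cast
      rfl
    rw [e]
    have e2 : (Real.pi : ℂ)⁻¹ * 2⁻¹ * ((∫ x in (0:ℝ)..(2 * Real.pi), (p x + p2 x) : ℝ) : ℂ) =
      (((2 * Real.pi)⁻¹ * ∫ x in (0:ℝ)..(2 * Real.pi), (p x + p2 x) : ℝ) : ℂ) := by
      push_cast
      rw [mul_inv, mul_comm (2:ℂ)⁻¹]
    rw [e2, Complex.norm_real, Real.norm_eq_abs, sq_abs]


lemma disk_case (p : ℝ → ℝ) (c : ℤ → ℂ)
    (hc : ∀ x : ℝ, HasSum (fun n : ℤ => c n * Complex.exp (Complex.I * n * x)) (p x))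
    (h : ∀ n : ℤ, n ≠ 0 → (n:ℝ) ^ 2 ≠ 1 → c n = 0) :
    ∃ a₀ a₁ b₁ : ℝ, ∀ θ : ℝ, p θ = a₀ + a₁ * Real.cos θ + b₁ * Real.sin θ := by
  refine ⟨(c 0).re, (c 1).re + (c (-1)).re, (c (-1)).im - (c 1).im, ?_⟩
  intro x
  have h1 : HasSum (fun n : ℤ => c n * Complex.exp (Complex.I * n * x))
      (∑ n ∈ ({0, 1, -1} : Finset ℤ), c n * Complex.exp (Complex.I * n * x)) := by
    apply hasSum_sum_of_ne_finset_zero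
    intro n hn
    simp at hn
    rw [h n hn.1 ?_, zero_mul]
    intro h9
    have h8 : (n - 1) * (n + 1) = 0 := by
      have : n ^ 2 = 1 := by exact_mod_cast h9
      linear_combination this
    rcases mul_eq_zero.1 h8 with h | h <;> omega
  have h2 := (hc x).unique h1
  rw [Finset.sum_insert (by decide), Finset.sum_pair (by decide)] at h2
  have e1 : Complex.exp (Complex.I * (1:ℤ) * x) = Real.cos x + Real.sin x * Complex.I := by
    push_cast
    rw [← Complex.exp_mul_I]
    congr 1
    ring
  have e2 : Complex.exp (Complex.I * (-1:ℤ) * x) = Real.cos x - Real.sin x * Complex.I := by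
    have : Complex.I * ((-1:ℤ):ℂ) * x = (-x : ℂ) * Complex.I := by push_cast; ring
    rw [this, Complex.exp_mul_I, Complex.cos_neg, Complex.sin_neg]
    push_cast
    ring
  rw [e1, e2] at h2
  have h3 := congrArg Complex.re h2
  simp [-Complex.ofReal_cos, -Complex.ofReal_sin] at h3
  rw [h3]
  ring

set_option maxHeartbeats 1000000 in
theorem stmt2
    (p : ℝ → ℝ)
    (hp : ContDiff ℝ (⊤ : ℕ∞) p)
    (hper : ∀ θ : ℝ, p (θ + 2 * Real.pi) = p θ)
    (ρ : ℝ → ℝ)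
    (hρdef : ρ = fun θ => p θ + iteratedDeriv 2 p θ)
    (hρpos : ∀ θ : ℝ, 0 < ρ θ)
    (L A : ℝ)
    (hL : L = ∫ θ in (0:ℝ)..(2 * Real.pi), ρ θ)
    (hA : A = (1 / 2) * ∫ θ in (0:ℝ)..(2 * Real.pi), (p θ ^ 2 - deriv p θ ^ 2))
    (Atilde : ℝ)
    (hAt : Atilde = (1 / 2) * ∫ θ in (0:ℝ)..(2 * Real.pi), (deriv p θ ^ 2 - iteratedDeriv 2 p θ ^ 2))
    (ρβ : ℝ → ℝ)
    (hρβ : ρβ = fun θ => |deriv p θ + iteratedDeriv 3 p θ|)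
    (ρM ρm : ℝ)
    (hρM : ρM = sSup (ρ '' Set.Icc (0:ℝ) (2 * Real.pi)))
    (hρm : ρm = sInf (ρ '' Set.Icc (0:ℝ) (2 * Real.pi)))
    (K : Set (EuclideanSpace ℝ (Fin 2)))
    (hK : K = {x | ∀ θ : ℝ, x 0 * Real.cos θ + x 1 * Real.sin θ ≤ p θ})
    (ρe ρi : ℝ)
    (hρe : ρe = sInf {r : ℝ | 0 ≤ r ∧ ∃ c, K ⊆ Metric.closedBall c r})
    (hρi : ρi = sSup {r : ℝ | 0 ≤ r ∧ ∃ c, Metric.closedBall c r ⊆ K})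
    (α δ μ σ η lam ξ ζ : ℝ)
    (W : ℝ)
    (hW : W = α * (∫ θ in (0:ℝ)..(2 * Real.pi), ρ θ ^ 2) + δ * L ^ 2 + μ * A + σ * |Atilde|
      + η * (∫ θ in (0:ℝ)..(2 * Real.pi), ρβ θ ^ 2) + lam * (ρe - ρi) ^ 2
      + ξ * (ρM - ρm) ^ 2 + ζ * (∫ θ in (0:ℝ)..(2 * Real.pi), (ρ θ)⁻¹))
    (hη : 0 ≤ η) (hξ : 0 ≤ ξ) (hζ : 0 ≤ ζ) (hlam : lam ≤ 0)
    (hc1 : 0 ≤ 2 * α + 4 * Real.pi * δ + μ - 4 * ζ)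
    (hc2 : 0 ≤ 2 * α + σ - 2 * η - 4 * ζ)
    (hc3 : 0 ≤ (6 * Real.pi * α - Real.pi * μ + 4 * Real.pi * σ + 24 * Real.pi * η + 4 * lam + 4 * ξ - 12 * Real.pi * ζ))
    (hnz : 0 < lam ^ 2 + ξ ^ 2 + ζ ^ 2)
    (heq : W = 0) :
    ∃ a₀ a₁ b₁ : ℝ, ∀ θ : ℝ, p θ = a₀ + a₁ * Real.cos θ + b₁ * Real.sin θ := by
  have hp1c : ∀ x, HasDerivAt p (deriv p x) x := fun x =>
    (hp.differentiable (by simp) x).hasDerivAt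
  have hit : ∀ k : ℕ, ∀ x, HasDerivAt (iteratedDeriv k p) (iteratedDeriv (k + 1) p x) x := by
    intro k x
    rw [iteratedDeriv_succ]
    exact (hp.differentiable_iteratedDeriv k (by exact_mod_cast WithTop.coe_lt_top k) x).hasDerivAt
  have h1 : ∀ x, HasDerivAt (deriv p) (iteratedDeriv 2 p x) x := by
    intro x
    have := hit 1 x
    rwa [iteratedDeriv_one] at this
  have h3c : Continuous (iteratedDeriv 3 p) := continuous_iff_continuousAt.2 fun x => (hit 3 x).continuousAt
  obtain ⟨c, hc, s0, s1, s2, s4, s5, hc0⟩ := pkg p (deriv p) (iteratedDeriv 2 p) (iteratedDeriv 3 p)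
    hp1c h1 (hit 2) h3c hper
  have k0 : Continuous p := hp.continuous
  have k1 : Continuous (deriv p) := continuous_iff_continuousAt.2 fun x => (h1 x).continuousAt
  have k2 : Continuous (iteratedDeriv 2 p) := continuous_iff_continuousAt.2 fun x => (hit 2 x).continuousAt
  have kρ : Continuous ρ := by rw [hρdef]; fun_prop
  have hpi := Real.pi_pos
  -- notation
  rw [intervalIntegral.integral_sub (Continuous.intervalIntegrable (by fun_prop) _ _)
    (Continuous.intervalIntegrable (by fun_prop) _ _)] at hA hAt
  have eβ : ∫ θ in (0:ℝ)..(2 * Real.pi), ρβ θ ^ 2 = ∫ θ in (0:ℝ)..(2 * Real.pi), (deriv p θ + iteratedDeriv 3 p θ) ^ 2 := by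
    rw [hρβ]; simp only [sq_abs]
  have eρ : ∫ θ in (0:ℝ)..(2 * Real.pi), ρ θ ^ 2 = ∫ θ in (0:ℝ)..(2 * Real.pi), (p θ + iteratedDeriv 2 p θ) ^ 2 := by
    rw [hρdef]
  have eL : L = ∫ θ in (0:ℝ)..(2 * Real.pi), (p θ + iteratedDeriv 2 p θ) := by
    rw [hL, hρdef]
  rw [← eL] at hc0
  rw [← eβ] at s5
  rw [← eρ] at s4
  obtain ⟨X0, hX0⟩ : ∃ X, X = (2 * Real.pi)⁻¹ * ∫ x in (0:ℝ)..(2 * Real.pi), p x ^ 2 := ⟨_, rfl⟩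
  obtain ⟨X1, hX1⟩ : ∃ X, X = (2 * Real.pi)⁻¹ * ∫ x in (0:ℝ)..(2 * Real.pi), deriv p x ^ 2 := ⟨_, rfl⟩
  obtain ⟨X2, hX2⟩ : ∃ X, X = (2 * Real.pi)⁻¹ * ∫ x in (0:ℝ)..(2 * Real.pi), iteratedDeriv 2 p x ^ 2 := ⟨_, rfl⟩
  obtain ⟨X4, hX4⟩ : ∃ X, X = (2 * Real.pi)⁻¹ * ∫ x in (0:ℝ)..(2 * Real.pi), ρ x ^ 2 := ⟨_, rfl⟩
  obtain ⟨X5, hX5⟩ : ∃ X, X = (2 * Real.pi)⁻¹ * ∫ x in (0:ℝ)..(2 * Real.pi), ρβ x ^ 2 := ⟨_, rfl⟩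
  obtain ⟨a0, ha0⟩ : ∃ a0, a0 = (2 * Real.pi)⁻¹ * L := ⟨_, rfl⟩
  rw [← hX0] at s0
  rw [← hX1] at s1
  rw [← hX2] at s2
  rw [← hX4] at s4
  rw [← hX5] at s5
  rw [← ha0] at hc0
  have f0 : ∫ x in (0:ℝ)..(2 * Real.pi), p x ^ 2 = 2 * Real.pi * X0 := by rw [hX0]; field_simp
  have f1 : ∫ x in (0:ℝ)..(2 * Real.pi), deriv p x ^ 2 = 2 * Real.pi * X1 := by rw [hX1]; field_simp
  have f2 : ∫ x in (0:ℝ)..(2 * Real.pi), iteratedDeriv 2 p x ^ 2 = 2 * Real.pi * X2 := by rw [hX2]; field_simp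
  have f4 : ∫ x in (0:ℝ)..(2 * Real.pi), ρ x ^ 2 = 2 * Real.pi * X4 := by rw [hX4]; field_simp
  have f5 : ∫ x in (0:ℝ)..(2 * Real.pi), ρβ x ^ 2 = 2 * Real.pi * X5 := by rw [hX5]; field_simp
  have fL : L = 2 * Real.pi * a0 := by rw [ha0]; field_simp
  rw [f0, f1] at hA
  rw [f1, f2] at hAt
  -- the sums
  have sδ : ∀ r : ℝ, HasSum (fun n : ℤ => if n = 0 then r else 0) r := fun r => hasSum_ite_eq 0 r
  have sz : HasSum (fun n : ℤ => (n:ℝ) ^ 2 * ‖c n‖ ^ 2 - ‖c n‖ ^ 2 + if n = 0 then ‖c 0‖ ^ 2 else 0)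
      (X1 - X0 + ‖c 0‖ ^ 2) := (s1.sub s0).add (sδ _)
  obtain ⟨z, hz⟩ : ∃ z : ℤ → ℝ, z = fun n : ℤ => (n:ℝ) ^ 2 * ‖c n‖ ^ 2 - ‖c n‖ ^ 2 + if n = 0 then ‖c 0‖ ^ 2 else 0 := ⟨_, rfl⟩
  obtain ⟨Z, hZ⟩ : ∃ Z, Z = X1 - X0 + ‖c 0‖ ^ 2 := ⟨_, rfl⟩
  rw [← hz, ← hZ] at sz
  have hz0 : z 0 = 0 := by rw [hz]; simp
  have hzn : ∀ n : ℤ, n ≠ 0 → z n = ((n:ℝ) ^ 2 - 1) * ‖c n‖ ^ 2 := by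
    intro n hn
    rw [hz]; simp [hn]; ring
  have hcases : ∀ n : ℤ, n = 0 ∨ (n ≠ 0 ∧ (n:ℝ) ^ 2 = 1) ∨ (n ≠ 0 ∧ 4 ≤ (n:ℝ) ^ 2 ) := by
    intro n
    by_cases h : n = 0
    · exact Or.inl h
    by_cases h' : (n:ℝ) ^ 2 = 1
    · exact Or.inr (Or.inl ⟨h, h'⟩)
    · exact Or.inr (Or.inr ⟨h, int_sq_ge n h' h⟩)
  have hznn : ∀ n, 0 ≤ z n := by
    intro n
    rcases hcases n with h | ⟨h, h'⟩ | ⟨h, h'⟩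
    · rw [h, hz0]
    · rw [hzn n h, h']; simp
    · rw [hzn n h]; exact mul_nonneg (by linarith) (by positivity)
  have hZ0 : 0 ≤ Z := sz.nonneg hznn
  rcases hZ0.eq_or_lt with hZe | hZp
  · apply disk_case p c hc
    intro n hn hn1
    rw [← hZe] at sz
    have hzz := (hasSum_zero_iff_of_nonneg hznn).1 sz
    have hzz := congrFun hzz n
    rw [hzn n hn] at hzz
    have := int_sq_ge n hn1 hn
    rcases mul_eq_zero.1 hzz with h | h
    · exfalso; linarith
    · simpa using h
  exfalso
  -- Bonnesen
  have hD : (ρe - ρi) ^ 2 < 4 * Z := by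
    have hsq : 0 < Real.sqrt Z := Real.sqrt_pos.2 hZp
    have hss : Real.sqrt Z ^ 2 = Z := Real.sq_sqrt hZ0
    obtain ⟨a, b, hab⟩ := annulus p c hc z Z sz hz0 hzn (2 / Real.sqrt Z) (by positivity)
      (1.96 * Real.sqrt Z) (by positivity) (by
        have e1 : 2 / Real.sqrt Z * Z = 2 * Real.sqrt Z := by
          rw [div_mul_eq_mul_div, div_eq_iff hsq.ne']
          linear_combination (-2) * hss
        have e2 : 3.8 / (2 / Real.sqrt Z) = 1.9 * Real.sqrt Z := by
          field_simp; norm_num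
        rw [e1, e2]
        linarith)
    have := geom p K hK ρe ρi hρe hρi _ a b (by positivity) hab
    rw [mul_pow, hss] at this
    linarith
  -- Popoviciu
  have h3Z : 3 * Z ≤ X4 - ‖c 0‖ ^ 2 := by
    refine hasSum_le (fun n => ?_) (sz.mul_left 3) (s4.sub (sδ _))
    rcases hcases n with h | ⟨h, h'⟩ | ⟨h, h'⟩
    · subst h; simp [hz0]
    · rw [hzn n h, h']; simp [h]
    · rw [hzn n h]
      simp only [h, if_false]
      have : 0 ≤ ‖c n‖ ^ 2 := by positivity
      nlinarith [mul_nonneg (mul_nonneg (show (0:ℝ) ≤ (n:ℝ) ^ 2 - 1 by linarith) (show (0:ℝ) ≤ (n:ℝ) ^ 2 - 4 by linarith)) this]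
  have hM : 12 * Z ≤ (ρM - ρm) ^ 2 := by
    have hcomp : IsCompact (ρ '' Set.Icc (0:ℝ) (2 * Real.pi)) := isCompact_Icc.image kρ
    have hle : ∀ x ∈ Set.Icc (0:ℝ) (2 * Real.pi), ρ x ≤ ρM := fun x hx => by
      rw [hρM]; exact le_csSup hcomp.bddAbove ⟨x, hx, rfl⟩
    have hge : ∀ x ∈ Set.Icc (0:ℝ) (2 * Real.pi), ρm ≤ ρ x := fun x hx => by
      rw [hρm]; exact csInf_le hcomp.bddBelow ⟨x, hx, rfl⟩
    have hint : 0 ≤ ∫ x in (0:ℝ)..(2 * Real.pi), (ρM - ρ x) * (ρ x - ρm) :=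
      intervalIntegral.integral_nonneg Real.two_pi_pos.le fun x hx =>
        mul_nonneg (by linarith [hle x hx]) (by linarith [hge x hx])
    have e : ∫ x in (0:ℝ)..(2 * Real.pi), (ρM - ρ x) * (ρ x - ρm)
        = (ρM + ρm) * (2 * Real.pi * a0) - 2 * Real.pi * X4 - 2 * Real.pi * (ρM * ρm) := by
      have : ∀ x, (ρM - ρ x) * (ρ x - ρm) = (ρM + ρm) * ρ x - ρ x ^ 2 - ρM * ρm := by intro x; ring
      simp only [this]
      rw [intervalIntegral.integral_sub (Continuous.intervalIntegrable (by fun_prop) _ _)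
        (Continuous.intervalIntegrable (by fun_prop) _ _),
        intervalIntegral.integral_sub (Continuous.intervalIntegrable (by fun_prop) _ _)
        (Continuous.intervalIntegrable (by fun_prop) _ _), intervalIntegral.integral_const_mul, ← hL, f4, fL,
        intervalIntegral.integral_const]
      simp
    rw [e] at hint
    have hint2 : 0 ≤ 2 * Real.pi * ((ρM + ρm) * a0 - X4 - ρM * ρm) := by linarith
    have hint3 := nonneg_of_mul_nonneg_right hint2 Real.two_pi_pos
    have h3Z' := h3Z
    rw [hc0] at h3Z'
    have e5 : (ρM - ρm) ^ 2 = 4 * ((ρM + ρm) * a0 - a0 ^ 2 - ρM * ρm) + (ρM + ρm - 2 * a0) ^ 2 := by ring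
    have e6 := sq_nonneg (ρM + ρm - 2 * a0)
    rw [e5]
    clear e5 e hint hint2
    linarith
  -- |Atilde|
  have hX21 : 0 ≤ X2 - X1 := by
    refine (s2.sub s1).nonneg fun n => ?_
    have : 0 ≤ ‖c n‖ ^ 2 := by positivity
    rcases hcases n with h | ⟨h, h'⟩ | ⟨h, h'⟩
    · simp [h]
    · have : (n:ℝ) ^ 4 = 1 := by rw [show (4:ℕ) = 2 * 2 from rfl, pow_mul, h']; norm_num
      simp [h', this]
    · have : (n:ℝ) ^ 4 * ‖c n‖ ^ 2 - (n:ℝ) ^ 2 * ‖c n‖ ^ 2 = (n:ℝ) ^ 2 * ((n:ℝ) ^ 2 - 1) * ‖c n‖ ^ 2 := by ring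
      rw [this]
      exact mul_nonneg (mul_nonneg (by positivity) (by linarith)) (by positivity)
  have hAabs : |Atilde| = Real.pi * (X2 - X1) := by
    have : Atilde = -(Real.pi * (X2 - X1)) := by rw [hAt]; ring
    rw [this, abs_neg, abs_of_nonneg (by positivity)]
  -- main estimate
  obtain ⟨B2, hB2⟩ : ∃ B, B = 3 * α - μ / 2 + 2 * σ + 12 * η := ⟨_, rfl⟩
  have hV : B2 * Z + (α + μ / 2) * ‖c 0‖ ^ 2 ≤ α * X4 + μ / 2 * (X0 - X1) + σ / 2 * (X2 - X1) + η * X5 := by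
    refine hasSum_le (fun n => ?_) ((sz.mul_left B2).add (sδ ((α + μ / 2) * ‖c 0‖ ^ 2)))
      ((((s4.mul_left α).add ((s0.sub s1).mul_left (μ / 2))).add ((s2.sub s1).mul_left (σ / 2))).add (s5.mul_left η))
    rcases hcases n with h | ⟨h, h'⟩ | ⟨h, h'⟩
    · subst h; simp [hz0]; linarith
    · have h4 : (n:ℝ) ^ 4 = 1 := by rw [show (4:ℕ) = 2 * 2 from rfl, pow_mul, h']; norm_num
      rw [hzn n h]; simp [h, h', h4]
    · rw [hzn n h]
      simp only [h, if_false]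
      have hP : 0 ≤ ‖c n‖ ^ 2 := by positivity
      have hfac : 0 ≤ ((n:ℝ) ^ 2 - 1) * ((n:ℝ) ^ 2 - 4) * (α + σ / 2 + η * ((n:ℝ) ^ 2 + 3)) * ‖c n‖ ^ 2 := by
        refine mul_nonneg (mul_nonneg (mul_nonneg (by linarith) (by linarith)) ?_) hP
        have hη2 := mul_nonneg hη (show (0:ℝ) ≤ (n:ℝ) ^ 2 by positivity)
        rw [mul_add]
        linarith
      rw [hB2]
      refine le_of_sub_nonneg (hfac.trans_eq ?_)
      ring
  have hinv : 0 < ∫ θ in (0:ℝ)..(2 * Real.pi), (ρ θ)⁻¹ := by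
    apply intervalIntegral.intervalIntegral_pos_of_pos
    · exact (kρ.inv₀ fun x => (hρpos x).ne').intervalIntegrable _ _
    · exact fun x => inv_pos.2 (hρpos x)
    · exact Real.two_pi_pos
  obtain ⟨V, hVd⟩ : ∃ V, V = ∫ θ in (0:ℝ)..(2 * Real.pi), (ρ θ)⁻¹ := ⟨_, rfl⟩
  obtain ⟨D, hDd⟩ : ∃ D, D = (ρe - ρi) ^ 2 := ⟨_, rfl⟩
  obtain ⟨M, hMd⟩ : ∃ M, M = (ρM - ρm) ^ 2 := ⟨_, rfl⟩
  rw [← hVd] at hinv hW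
  rw [← hDd] at hD hW
  rw [← hMd] at hM hW
  rw [f4, f5, hAabs, hA, fL, heq] at hW
  have hV2 := mul_le_mul_of_nonneg_left hV Real.two_pi_pos.le
  have hc3' : 0 ≤ (2 * Real.pi * B2 + 4 * lam + 4 * ξ) * Z := by
    apply mul_nonneg _ hZ0
    rw [hB2]
    have hpz := mul_nonneg hpi.le hζ
    linarith
  have hc1' : 0 ≤ Real.pi * (2 * α + 4 * Real.pi * δ + μ) * ‖c 0‖ ^ 2 :=
    mul_nonneg (mul_nonneg hpi.le (by linarith)) (by positivity)
  have hfin : -lam * (4 * Z - D) + ξ * (M - 4 * Z) + ζ * V ≤ 0 := by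
    rw [hc0] at hc1' hV2
    linarith
  have t1 : 0 ≤ -lam * (4 * Z - D) := mul_nonneg (by linarith) (by linarith)
  have t2 : 0 ≤ ξ * (M - 4 * Z) := mul_nonneg hξ (by linarith)
  have t3 : 0 ≤ ζ * V := mul_nonneg hζ hinv.le
  have u1 : lam = 0 := by
    have : -lam * (4 * Z - D) = 0 := by linarith
    rcases mul_eq_zero.1 this with h | h <;> linarith
  have u2 : ξ = 0 := by
    have : ξ * (M - 4 * Z) = 0 := by linarith
    rcases mul_eq_zero.1 this with h | h <;> linarith
  have u3 : ζ = 0 := by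
    have : ζ * V = 0 := by linarith
    rcases mul_eq_zero.1 this with h | h <;> linarith
  rw [u1, u2, u3] at hnz
  norm_num at hnz
end
end
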